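/- Let 𝔸, 𝔹 be generalized algebraic theories, h ≥ 0, and suppose the pair (𝔸,𝔹) is h-derivable. Let X = (x₁:X₁,…,x_m:X_m) and Y = (y₁:Y₁,…,yₙ:Yₙ) be contexts of 𝔸, 𝔹 respectively. (1) If X ⊢ u : U is derivable in 𝔸 with ht(X ⊢ u:U) · ht(Y) ≤ h, then, setting X' = (X, x:U) for a variable x not in X, the tuple (x₁,…,x_m,u^U) ⊗ Y is a context morphism X⊗Y → X'⊗Y in 𝔸⊗𝔹. (2) Symmetrically, if Y ⊢ v : V is derivable in 𝔹 with ht(X) · ht(Y ⊢ v:V) ≤ h, then, setting Y' = (Y, y:V) for a variable y not in Y, the tuple X ⊗ (y₁,…,yₙ,v^V) is a context morphism X⊗Y → X⊗Y'. -/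

import Mathlib

set_option linter.unusedVariables false

/-! # Syntax of generalized algebraic theories (following Cartmell / the paper's appendix) -/

namespace GATPaper

/-- A sort-and-term alphabet: a countably infinite set of variables, a set of sort
symbols and a set of term symbols. -/
structure Alphabet : Type 1 where
  Var : Type
  SortSym : Type
  TermSym : Type
  var_infinite : Infinite Var
  var_countable : Countable Var

attribute [instance] Alphabet.var_infinite Alphabet.var_countable

variable {A B : Alphabet}

/-- Term expressions over an alphabet. -/
inductive Expr (A : Alphabet) : Type where
  | var : A.Var → Expr A
  | app : A.TermSym → List (Expr A) → Expr A

/-- Sort expressions: a sort symbol applied to a list of term expressions. -/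
structure SortE (A : Alphabet) : Type where
  head : A.SortSym
  args : List (Expr A)

/-- Occurrence of a variable in a term expression. -/
inductive Occurs (x : A.Var) : Expr A → Prop where
  | var : Occurs x (Expr.var x)
  | app {t : A.TermSym} {es : List (Expr A)} {e : Expr A} :
      e ∈ es → Occurs x e → Occurs x (Expr.app t es)

/-- Occurrence of a variable in a sort expression. -/
def SOccurs (x : A.Var) (U : SortE A) : Prop := ∃ e ∈ U.args, Occurs x e

/-- Simultaneous substitution along a function on variables. -/
def Expr.subst (σ : A.Var → Expr A) : Expr A → Expr A
  | .var x => σ x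
  | .app t es => .app t (es.attach.map fun e => Expr.subst σ e.1)
termination_by e => sizeOf e
decreasing_by
  have := List.sizeOf_lt_of_mem e.2
  simp only [Expr.app.sizeOf_spec]
  omega

def SortE.subst (σ : A.Var → Expr A) (U : SortE A) : SortE A :=
  ⟨U.head, U.args.map (Expr.subst σ)⟩

open Classical in
/-- The function on variables determined by a finite list of substitution pairs
`(zᵢ, uᵢ)` (substituting `uᵢ` for `zᵢ`, first matching pair winning, all other
variables unchanged). -/
noncomputable def lookupV : List (A.Var × Expr A) → A.Var → Expr A
  | [], x => .var x
  | p :: ps, x => if p.1 = x then p.2 else lookupV ps x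

/-- The simultaneous substitution `e[u₁ | z₁, …, u_k | z_k]` where
`ps = [(z₁,u₁),…,(z_k,u_k)]`. -/
noncomputable def Expr.substL (e : Expr A) (ps : List (A.Var × Expr A)) : Expr A :=
  e.subst (lookupV ps)

noncomputable def SortE.substL (U : SortE A) (ps : List (A.Var × Expr A)) : SortE A :=
  U.subst (lookupV ps)

/-- A (pre)context is a finite list of (variable, sort expression) pairs. -/
abbrev PreCtx (A : Alphabet) := List (A.Var × SortE A)

/-- The list of variables of a precontext, as term expressions. -/
def ctxVars (X : PreCtx A) : List (Expr A) := X.map fun p => Expr.var p.1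

/-- The scoping condition of a precontext: the `i`-th sort expression only contains
variables among the first `i` variables. -/
def IsPreCtx (X : PreCtx A) : Prop :=
  ∀ i (hi : i < X.length) (v : A.Var),
    SOccurs v (X[i]'hi).2 → v ∈ (X.take i).map Prod.fst

/-- Substitution pairs sending the variables of `X` to the entries of `f`. -/
def mkSub (X : PreCtx A) (f : List (Expr A)) : List (A.Var × Expr A) :=
  (X.map Prod.fst).zip f

/-- `Xᵢ[f₁ | x₁, …, f_{i-1} | x_{i-1}]` (0-based: the `i`-th sort of `X`
substituted along the first `i` entries of `f`). -/
noncomputable def subPre (X : PreCtx A) (f : List (Expr A)) (i : ℕ) (hi : i < X.length) :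
    SortE A :=
  ((X[i]'hi).2).substL (mkSub (X.take i) (f.take i))

/-- Judgments: context judgments and the four kinds of standard judgments. -/
inductive Judg (A : Alphabet) : Type where
  | ctx (X : PreCtx A)
  | sort (X : PreCtx A) (U : SortE A)
  | term (X : PreCtx A) (u : Expr A) (U : SortE A)
  | sortEq (X : PreCtx A) (U V : SortE A)
  | termEq (X : PreCtx A) (u v : Expr A) (U : SortE A)

/-- The context of a judgment. -/
def Judg.ctxOf : Judg A → PreCtx A
  | .ctx X => X
  | .sort X _ => X
  | .term X _ _ => X
  | .sortEq X _ _ => X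
  | .termEq X _ _ _ => X

/-- The judgment introducing a sort symbol over the context `X`. -/
def introSort (X : PreCtx A) (S : A.SortSym) : Judg A := .sort X ⟨S, ctxVars X⟩

/-- The judgment introducing a term symbol over the context `X`, with sort `U`. -/
def introTerm (X : PreCtx A) (t : A.TermSym) (U : SortE A) : Judg A :=
  .term X (.app t (ctxVars X)) U

/-- A set of axioms is a pretheory if: no axiom is a context judgment, every
axiom's context is a precontext, every sort symbol has a unique introducing sort
axiom and there are no other sort axioms, and likewise for term symbols. -/
structure IsPretheory (Ax : Set (Judg A)) : Prop where
  no_ctx : ∀ X : PreCtx A, Judg.ctx X ∉ Ax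
  wf_ctx : ∀ J ∈ Ax, IsPreCtx J.ctxOf
  sort_intro : ∀ S : A.SortSym, ∃! X : PreCtx A, introSort X S ∈ Ax
  sort_shape : ∀ (X : PreCtx A) (U : SortE A), Judg.sort X U ∈ Ax → U.args = ctxVars X
  term_intro : ∀ t : A.TermSym, ∃! p : PreCtx A × SortE A, introTerm p.1 t p.2 ∈ Ax
  term_shape : ∀ (X : PreCtx A) (u : Expr A) (U : SortE A), Judg.term X u U ∈ Ax →
      ∃ t : A.TermSym, u = Expr.app t (ctxVars X)

/-- One inference step of the paper's system: `Step Ax D J` holds when `J` is the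
conclusion of an instance of one of the sixteen rules all of whose premises
satisfy `D`. -/
inductive Step (Ax : Set (Judg A)) (D : Judg A → Prop) : Judg A → Prop where
  | ctx_nil : Step Ax D (.ctx [])
  | ctx_cons {X : PreCtx A} {U : SortE A} {x : A.Var}
      (hs : D (.sort X U)) (hfresh : ∀ p ∈ X, p.1 ≠ x)
      (hpre : IsPreCtx (X ++ [(x, U)])) :
      Step Ax D (.ctx (X ++ [(x, U)]))
  | s1 {X : PreCtx A} {U : SortE A} (h : D (.sort X U)) : Step Ax D (.sortEq X U U)
  | s2 {X : PreCtx A} {U V : SortE A} (h : D (.sortEq X U V)) : Step Ax D (.sortEq X V U)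
  | s3 {X : PreCtx A} {U V W : SortE A}
      (h1 : D (.sortEq X U V)) (h2 : D (.sortEq X V W)) : Step Ax D (.sortEq X U W)
  | t1 {X : PreCtx A} {u : Expr A} {U : SortE A}
      (h : D (.term X u U)) : Step Ax D (.termEq X u u U)
  | t2 {X : PreCtx A} {u v : Expr A} {U : SortE A}
      (h : D (.termEq X u v U)) : Step Ax D (.termEq X v u U)
  | t3 {X : PreCtx A} {u v w : Expr A} {U : SortE A}
      (h1 : D (.termEq X u v U)) (h2 : D (.termEq X v w U)) : Step Ax D (.termEq X u w U)
  | seqt {X : PreCtx A} {U U' : SortE A} {u : Expr A}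
      (h1 : D (.sortEq X U U')) (h2 : D (.term X u U)) : Step Ax D (.term X u U')
  | seqteq {X : PreCtx A} {U U' : SortE A} {u u' : Expr A}
      (h1 : D (.sortEq X U U')) (h2 : D (.termEq X u u' U))
      (h3 : D (.term X u U')) (h4 : D (.term X u' U')) : Step Ax D (.termEq X u u' U')
  | var {X : PreCtx A} {i : ℕ} (hi : i < X.length)
      (h : D (.sort X (X[i]'hi).2)) :
      Step Ax D (.term X (.var (X[i]'hi).1) (X[i]'hi).2)
  | sA {X : PreCtx A} {U : SortE A} (hax : Judg.sort X U ∈ Ax) (h : D (.ctx X))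
      (hv : ∀ i (hi : i < X.length), D (.term X (.var (X[i]'hi).1) (X[i]'hi).2)) :
      Step Ax D (.sort X U)
  | tA {X : PreCtx A} {u : Expr A} {U : SortE A} (hax : Judg.term X u U ∈ Ax)
      (h : D (.sort X U))
      (hv : ∀ i (hi : i < X.length), D (.term X (.var (X[i]'hi).1) (X[i]'hi).2)) :
      Step Ax D (.term X u U)
  | seqA {X : PreCtx A} {U U' : SortE A} (hax : Judg.sortEq X U U' ∈ Ax)
      (h1 : D (.sort X U)) (h2 : D (.sort X U')) : Step Ax D (.sortEq X U U')
  | teqA {X : PreCtx A} {u u' : Expr A} {U : SortE A} (hax : Judg.termEq X u u' U ∈ Ax)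
      (h1 : D (.term X u U)) (h2 : D (.term X u' U)) : Step Ax D (.termEq X u u' U)
  | sSub {X : PreCtx A} {S : A.SortSym} (hax : introSort X S ∈ Ax)
      {Y : PreCtx A} (hY : IsPreCtx Y) {f : List (Expr A)} (hlen : f.length = X.length)
      (hJ : D (introSort X S)) (hYc : D (.ctx Y))
      (hargs : ∀ i (hi : i < X.length) (hif : i < f.length),
        D (.term Y (f[i]'hif) (subPre X f i hi))) :
      Step Ax D (.sort Y ⟨S, f⟩)
  | tSub {X : PreCtx A} {t : A.TermSym} {U : SortE A} (hax : introTerm X t U ∈ Ax)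
      {Y : PreCtx A} (hY : IsPreCtx Y) {f : List (Expr A)} (hlen : f.length = X.length)
      (hJ : D (introTerm X t U))
      (hU : D (.sort Y (U.substL (mkSub X f))))
      (hargs : ∀ i (hi : i < X.length) (hif : i < f.length),
        D (.term Y (f[i]'hif) (subPre X f i hi))) :
      Step Ax D (.term Y (.app t f) (U.substL (mkSub X f)))
  | seqSub1 {X : PreCtx A} {U U' : SortE A} (hax : Judg.sortEq X U U' ∈ Ax)
      {Y : PreCtx A} (hY : IsPreCtx Y) {f : List (Expr A)} (hlen : f.length = X.length)
      (hJ : D (.sortEq X U U'))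
      (h1 : D (.sort Y (U.substL (mkSub X f)))) (h2 : D (.sort Y (U'.substL (mkSub X f))))
      (hargs : ∀ i (hi : i < X.length) (hif : i < f.length),
        D (.term Y (f[i]'hif) (subPre X f i hi))) :
      Step Ax D (.sortEq Y (U.substL (mkSub X f)) (U'.substL (mkSub X f)))
  | seqSub2 {X : PreCtx A} {S : A.SortSym} (hax : introSort X S ∈ Ax)
      {Y : PreCtx A} (hY : IsPreCtx Y) {f g : List (Expr A)}
      (hlf : f.length = X.length) (hlg : g.length = X.length)
      (hJ : D (introSort X S))
      (h1 : D (.sort Y ⟨S, f⟩)) (h2 : D (.sort Y ⟨S, g⟩))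
      (hargs : ∀ i (hi : i < X.length) (hif : i < f.length) (hig : i < g.length),
        D (.termEq Y (f[i]'hif) (g[i]'hig) (subPre X f i hi))) :
      Step Ax D (.sortEq Y ⟨S, f⟩ ⟨S, g⟩)
  | teqSub1 {X : PreCtx A} {u u' : Expr A} {U : SortE A}
      (hax : Judg.termEq X u u' U ∈ Ax)
      {Y : PreCtx A} (hY : IsPreCtx Y) {f : List (Expr A)} (hlen : f.length = X.length)
      (hJ : D (.termEq X u u' U))
      (h1 : D (.term Y (u.substL (mkSub X f)) (U.substL (mkSub X f))))
      (h2 : D (.term Y (u'.substL (mkSub X f)) (U.substL (mkSub X f))))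
      (hargs : ∀ i (hi : i < X.length) (hif : i < f.length),
        D (.term Y (f[i]'hif) (subPre X f i hi))) :
      Step Ax D (.termEq Y (u.substL (mkSub X f)) (u'.substL (mkSub X f))
        (U.substL (mkSub X f)))
  | teqSub2 {X : PreCtx A} {t : A.TermSym} {U : SortE A} (hax : introTerm X t U ∈ Ax)
      {Y : PreCtx A} (hY : IsPreCtx Y) {f g : List (Expr A)}
      (hlf : f.length = X.length) (hlg : g.length = X.length)
      (hJ : D (introTerm X t U))
      (h1 : D (.term Y (.app t f) (U.substL (mkSub X f))))
      (h2 : D (.term Y (.app t g) (U.substL (mkSub X f))))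
      (hargs : ∀ i (hi : i < X.length) (hif : i < f.length) (hig : i < g.length),
        D (.termEq Y (f[i]'hif) (g[i]'hig) (subPre X f i hi))) :
      Step Ax D (.termEq Y (.app t f) (.app t g) (U.substL (mkSub X f)))

/-- `DerAt Ax n J`: `J` is the conclusion of an inference step in the `n`-th stage
`𝒟ₙ` of the recursive construction of the derivable judgments. -/
def DerAt (Ax : Set (Judg A)) : ℕ → Judg A → Prop
  | 0, _ => False
  | n + 1, J => DerAt Ax n J ∨ Step Ax (DerAt Ax n) J

/-- A judgment is derivable if it is the conclusion of a step of some stage. -/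
def Derivable (Ax : Set (Judg A)) (J : Judg A) : Prop := ∃ n, DerAt Ax n J

/-- The height of a (derivable) judgment: the least stage at which it appears. -/
noncomputable def ht (Ax : Set (Judg A)) (J : Judg A) : ℕ := sInf {n | DerAt Ax n J}

/-- The height of a context: `0` for the empty context, and the height of
`∂X ⊢ Xₙ sort` otherwise. -/
noncomputable def htCtx (Ax : Set (Judg A)) (X : PreCtx A) : ℕ :=
  match X with
  | [] => 0
  | p :: X' =>
      ht Ax (.sort ((p :: X').dropLast) (((p :: X').getLast (List.cons_ne_nil p X')).2))

/-- A generalized algebraic theory: a pretheory all of whose axioms are derivable. -/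
def IsGAT (Ax : Set (Judg A)) : Prop := IsPretheory Ax ∧ ∀ J ∈ Ax, Derivable Ax J

/-- The partial term judgment `X ⊢ u term` is derivable. -/
def DerTerm (Ax : Set (Judg A)) (X : PreCtx A) (u : Expr A) : Prop :=
  ∃ U, Derivable Ax (.term X u U)

/-- The partial term equality judgment `X ⊢ u ≡ v term` is derivable. -/
def DerTermEq (Ax : Set (Judg A)) (X : PreCtx A) (u v : Expr A) : Prop :=
  ∃ U, Derivable Ax (.termEq X u v U)

/-- Height of a derivable partial term judgment: the minimum of the heights of
`X ⊢ u : U` over all `U`. -/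
noncomputable def htTerm (Ax : Set (Judg A)) (X : PreCtx A) (u : Expr A) : ℕ :=
  sInf {n | ∃ U, DerAt Ax n (.term X u U)}

/-- `f` is a context morphism from `X` to `Y`. -/
def IsMor (Ax : Set (Judg A)) (X Y : PreCtx A) (f : List (Expr A)) : Prop :=
  Derivable Ax (.ctx X) ∧ Derivable Ax (.ctx Y) ∧ f.length = Y.length ∧
  ∀ i (hi : i < Y.length) (hif : i < f.length),
    Derivable Ax (.term X (f[i]'hif) (subPre Y f i hi))

/-- The morphism equality `f ≡ g : X → Y` is derivable. -/
def MorEq (Ax : Set (Judg A)) (X Y : PreCtx A) (f g : List (Expr A)) : Prop :=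
  IsMor Ax X Y f ∧ IsMor Ax X Y g ∧
  ∀ i (hi : i < Y.length) (hif : i < f.length) (hig : i < g.length),
    Derivable Ax (.termEq X (f[i]'hif) (g[i]'hig) (subPre Y f i hi))

/-- The context equality `X ≡ Y ctx` is derivable. -/
def CtxEq (Ax : Set (Judg A)) (X Y : PreCtx A) : Prop :=
  X.length = Y.length ∧ Derivable Ax (.ctx X) ∧ Derivable Ax (.ctx Y) ∧
  ∀ i (hX : i < X.length) (hY : i < Y.length),
    Derivable Ax (.sortEq (X.take i) (X[i]'hX).2
      (((Y[i]'hY).2).substL (mkSub (Y.take i) (ctxVars (X.take i)))))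

/-- Height of a context morphism. -/
noncomputable def htMor (Ax : Set (Judg A)) (X Y : PreCtx A) (f : List (Expr A)) : ℕ :=
  max (htCtx Ax X) (max (htCtx Ax Y)
    ((Finset.range Y.length).sup fun i =>
      if h : i < Y.length ∧ i < f.length then
        ht Ax (.term X (f[i]'h.2) (subPre Y f i h.1))
      else 0))

/-- Height of a morphism equality. -/
noncomputable def htMorEq (Ax : Set (Judg A)) (X Y : PreCtx A) (f g : List (Expr A)) : ℕ :=
  max (htMor Ax X Y f) (max (htMor Ax X Y g)
    ((Finset.range Y.length).sup fun i =>
      if h : i < Y.length ∧ i < f.length ∧ i < g.length then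
        ht Ax (.termEq X (f[i]'h.2.1) (g[i]'h.2.2) (subPre Y f i h.1))
      else 0))

/-- The composite `g ∘ f` of tuples of term expressions, where `f : X → Y` and
`g : Y → Z`: the `i`-th entry is `gᵢ[f]`. -/
noncomputable def compMor (Y : PreCtx A) (f g : List (Expr A)) : List (Expr A) :=
  g.map fun e => e.substL (mkSub Y f)

/-- The canonical sort `𝒮(u)` of a term in a context (as a relation). -/
inductive CanonSort (Ax : Set (Judg A)) (X : PreCtx A) : Expr A → SortE A → Prop where
  | var {i : ℕ} (hi : i < X.length) : CanonSort Ax X (.var (X[i]'hi).1) (X[i]'hi).2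
  | app {t : A.TermSym} {f : List (Expr A)} {Xa : PreCtx A} {V : SortE A}
      (hax : introTerm Xa t V ∈ Ax) :
      CanonSort Ax X (.app t f) (V.substL (mkSub Xa f))


/-! ## The tensor product of generalized algebraic theories (§2 of the paper) -/

/-- The tensor product of two sort-and-term alphabets. -/
abbrev Alphabet.tensor (A B : Alphabet) : Alphabet :=
  { Var := A.Var × B.Var
    SortSym := A.SortSym × B.SortSym
    TermSym := (A.SortSym × B.TermSym) ⊕ (A.TermSym × B.SortSym)
    var_infinite := inferInstance
    var_countable := inferInstance }

/-- An input for the tensor term operations `⊗_t`, `●_t`: a derivable term judgment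
`X ⊢ u : U` (notation `u^U`), or an augmented derivable sort judgment
`(X ⊢ U sort, x)` (notation `x^U`), represented with `tm = var x`. -/
structure TArg (A : Alphabet) : Type where
  ctx : PreCtx A
  tm : Expr A
  srt : SortE A

/-- `L` is the lexicographically ordered `m × n` grid whose `(i,j)` entry is `M i j`. -/
def IsGrid {γ : Type} (m n : ℕ) (M : ℕ → ℕ → γ) (L : List γ) : Prop :=
  L.length = m * n ∧
  ∀ i j (hi : i < m) (hj : j < n) (h : i * n + j < L.length), L[i * n + j]'h = M i j

/-- Substitution pairs `[g 1 | x y₁, …, g n | x yₙ]` where the `yⱼ` are the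
variables of `Y`. -/
def pairsR (x : A.Var) (Y : PreCtx B) (g : ℕ → Expr (A.tensor B)) :
    List ((A.tensor B).Var × Expr (A.tensor B)) :=
  (List.finRange Y.length).map fun j => ((x, (Y.get j).1), g j.1)

/-- Substitution pairs `[g 1 | x₁ y, …, g m | x_m y]` where the `xᵢ` are the
variables of `X`. -/
def pairsL (X : PreCtx A) (y : B.Var) (g : ℕ → Expr (A.tensor B)) :
    List ((A.tensor B).Var × Expr (A.tensor B)) :=
  (List.finRange X.length).map fun i => (((X.get i).1, y), g i.1)

variable {A B : Alphabet}

/-- The graph of the tensor term operation on pairs of (augmented sort / term)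
judgments: `TTg TA TB false a b e` means `e = a ⊗_t b` and
`TTg TA TB true a b e` means `e = a ⊗*_t b` (the variant of §8 in which the two
defining substitution formulas for non-variable terms are interchanged). -/
inductive TTg (TA : Set (Judg A)) (TB : Set (Judg B)) :
    Bool → TArg A → TArg B → Expr (A.tensor B) → Prop where
  | varvar {b : Bool} {X : PreCtx A} {U : SortE A} {x : A.Var}
      {Y : PreCtx B} {V : SortE B} {y : B.Var} :
      TTg TA TB b ⟨X, .var x, U⟩ ⟨Y, .var y, V⟩ (.var (x, y))
  | varapp {b : Bool} {X : PreCtx A} {x : A.Var} {S : A.SortSym} {ss : List (Expr A)}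
      {Y : PreCtx B} {t : B.TermSym} {ts : List (Expr B)} {V : SortE B}
      (SS : ℕ → SortE A) (TSf : ℕ → SortE B)
      (hSS : ∀ i (hi : i < ss.length), CanonSort TA X (ss[i]'hi) (SS i))
      (hTS : ∀ j (hj : j < ts.length), CanonSort TB Y (ts[j]'hj) (TSf j))
      (M : ℕ → ℕ → Expr (A.tensor B)) (out : List (Expr (A.tensor B)))
      (hM : ∀ i (hi : i < ss.length), ∀ j (hj : j < ts.length),
          TTg TA TB b ⟨X, ss[i]'hi, SS i⟩ ⟨Y, ts[j]'hj, TSf j⟩ (M i j))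
      (hMx : ∀ j (hj : j < ts.length),
          TTg TA TB b ⟨X, .var x, ⟨S, ss⟩⟩ ⟨Y, ts[j]'hj, TSf j⟩ (M ss.length j))
      (hout : IsGrid (ss.length + 1) ts.length M out) :
      TTg TA TB b ⟨X, .var x, ⟨S, ss⟩⟩ ⟨Y, .app t ts, V⟩ (.app (Sum.inl (S, t)) out)
  | appvar {b : Bool} {X : PreCtx A} {s : A.TermSym} {ss : List (Expr A)} {U : SortE A}
      {Y : PreCtx B} {y : B.Var} {T : B.SortSym} {ts : List (Expr B)}
      (SS : ℕ → SortE A) (TSf : ℕ → SortE B)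
      (hSS : ∀ i (hi : i < ss.length), CanonSort TA X (ss[i]'hi) (SS i))
      (hTS : ∀ j (hj : j < ts.length), CanonSort TB Y (ts[j]'hj) (TSf j))
      (M : ℕ → ℕ → Expr (A.tensor B)) (out : List (Expr (A.tensor B)))
      (hM : ∀ i (hi : i < ss.length), ∀ j (hj : j < ts.length),
          TTg TA TB b ⟨X, ss[i]'hi, SS i⟩ ⟨Y, ts[j]'hj, TSf j⟩ (M i j))
      (hMy : ∀ i (hi : i < ss.length),
          TTg TA TB b ⟨X, ss[i]'hi, SS i⟩ ⟨Y, .var y, ⟨T, ts⟩⟩ (M i ts.length))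
      (hout : IsGrid ss.length (ts.length + 1) M out) :
      TTg TA TB b ⟨X, .app s ss, U⟩ ⟨Y, .var y, ⟨T, ts⟩⟩ (.app (Sum.inr (s, T)) out)
  | appapp_base {X : PreCtx A} {s : A.TermSym} {ss : List (Expr A)} {U : SortE A}
      {Y : PreCtx B} {t : B.TermSym} {ts : List (Expr B)} {V : SortE B} {x : A.Var}
      (hx : ∀ p ∈ X, p.1 ≠ x)
      (e0 : Expr (A.tensor B))
      (h0 : TTg TA TB false ⟨X, .var x, U⟩ ⟨Y, .app t ts, V⟩ e0)
      (g : ℕ → Expr (A.tensor B))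
      (hg : ∀ j (hj : j < Y.length),
          TTg TA TB false ⟨X, .app s ss, U⟩
            ⟨Y.take j, .var (Y[j]'hj).1, (Y[j]'hj).2⟩ (g j)) :
      TTg TA TB false ⟨X, .app s ss, U⟩ ⟨Y, .app t ts, V⟩ (e0.substL (pairsR x Y g))
  | appapp_star {X : PreCtx A} {s : A.TermSym} {ss : List (Expr A)} {U : SortE A}
      {Y : PreCtx B} {t : B.TermSym} {ts : List (Expr B)} {V : SortE B} {y : B.Var}
      (hy : ∀ p ∈ Y, p.1 ≠ y)
      (e0 : Expr (A.tensor B))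
      (h0 : TTg TA TB true ⟨X, .app s ss, U⟩ ⟨Y, .var y, V⟩ e0)
      (g : ℕ → Expr (A.tensor B))
      (hg : ∀ i (hi : i < X.length),
          TTg TA TB true ⟨X.take i, .var (X[i]'hi).1, (X[i]'hi).2⟩
            ⟨Y, .app t ts, V⟩ (g i)) :
      TTg TA TB true ⟨X, .app s ss, U⟩ ⟨Y, .app t ts, V⟩ (e0.substL (pairsL X y g))

/-- The graph of the operation `●_t` (flag `false`), resp. of `●*_t` (flag `true`). -/
inductive TTd (TA : Set (Judg A)) (TB : Set (Judg B)) :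
    Bool → TArg A → TArg B → Expr (A.tensor B) → Prop where
  | varL {b : Bool} {X : PreCtx A} {x : A.Var} {U : SortE A} {bArg : TArg B}
      {e : Expr (A.tensor B)}
      (h : TTg TA TB b ⟨X, .var x, U⟩ bArg e) : TTd TA TB b ⟨X, .var x, U⟩ bArg e
  | varR {b : Bool} {aArg : TArg A} {Y : PreCtx B} {y : B.Var} {V : SortE B}
      {e : Expr (A.tensor B)}
      (h : TTg TA TB b aArg ⟨Y, .var y, V⟩ e) : TTd TA TB b aArg ⟨Y, .var y, V⟩ e
  | appapp_base {X : PreCtx A} {s : A.TermSym} {ss : List (Expr A)} {U : SortE A}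
      {Y : PreCtx B} {t : B.TermSym} {ts : List (Expr B)} {V : SortE B} {y : B.Var}
      (hy : ∀ p ∈ Y, p.1 ≠ y)
      (e0 : Expr (A.tensor B))
      (h0 : TTg TA TB false ⟨X, .app s ss, U⟩ ⟨Y, .var y, V⟩ e0)
      (g : ℕ → Expr (A.tensor B))
      (hg : ∀ i (hi : i < X.length),
          TTg TA TB false ⟨X.take i, .var (X[i]'hi).1, (X[i]'hi).2⟩
            ⟨Y, .app t ts, V⟩ (g i)) :
      TTd TA TB false ⟨X, .app s ss, U⟩ ⟨Y, .app t ts, V⟩ (e0.substL (pairsL X y g))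
  | appapp_star {X : PreCtx A} {s : A.TermSym} {ss : List (Expr A)} {U : SortE A}
      {Y : PreCtx B} {t : B.TermSym} {ts : List (Expr B)} {V : SortE B} {x : A.Var}
      (hx : ∀ p ∈ X, p.1 ≠ x)
      (e0 : Expr (A.tensor B))
      (h0 : TTg TA TB true ⟨X, .var x, U⟩ ⟨Y, .app t ts, V⟩ e0)
      (g : ℕ → Expr (A.tensor B))
      (hg : ∀ j (hj : j < Y.length),
          TTg TA TB true ⟨X, .app s ss, U⟩
            ⟨Y.take j, .var (Y[j]'hj).1, (Y[j]'hj).2⟩ (g j)) :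
      TTd TA TB true ⟨X, .app s ss, U⟩ ⟨Y, .app t ts, V⟩ (e0.substL (pairsR x Y g))

/-- The graph of the tensor sort operation `⊗_s` (resp. `⊗*_s` for flag `true`):
`TSo TA TB b X x U Y y V W` means `W = U^x ⊗ V^y`. -/
inductive TSo (TA : Set (Judg A)) (TB : Set (Judg B)) :
    Bool → PreCtx A → A.Var → SortE A → PreCtx B → B.Var → SortE B →
    SortE (A.tensor B) → Prop where
  | mk {b : Bool} {X : PreCtx A} {x : A.Var} {S : A.SortSym} {ss : List (Expr A)}
      {Y : PreCtx B} {y : B.Var} {T : B.SortSym} {ts : List (Expr B)}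
      (hx : ∀ p ∈ X, p.1 ≠ x) (hy : ∀ p ∈ Y, p.1 ≠ y)
      (SS : ℕ → SortE A) (TSf : ℕ → SortE B)
      (hSS : ∀ i (hi : i < ss.length), CanonSort TA X (ss[i]'hi) (SS i))
      (hTS : ∀ j (hj : j < ts.length), CanonSort TB Y (ts[j]'hj) (TSf j))
      (M : ℕ → ℕ → Expr (A.tensor B)) (out : List (Expr (A.tensor B)))
      (hM : ∀ i (hi : i < ss.length), ∀ j (hj : j < ts.length),
          TTg TA TB b ⟨X, ss[i]'hi, SS i⟩ ⟨Y, ts[j]'hj, TSf j⟩ (M i j))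
      (hMx : ∀ j (hj : j < ts.length),
          TTg TA TB b ⟨X, .var x, ⟨S, ss⟩⟩ ⟨Y, ts[j]'hj, TSf j⟩ (M ss.length j))
      (hMy : ∀ i (hi : i < ss.length),
          TTg TA TB b ⟨X, ss[i]'hi, SS i⟩ ⟨Y, .var y, ⟨T, ts⟩⟩ (M i ts.length))
      (hout : IsGrid (ss.length + 1) (ts.length + 1) M out) :
      TSo TA TB b X x ⟨S, ss⟩ Y y ⟨T, ts⟩ ⟨(S, T), out.dropLast⟩

/-- The tensor precontext `Z = X ⊗ Y`, with entries `xᵢyⱼ : Xᵢ ⊗ Yⱼ` ordered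
lexicographically. -/
def TCtx (TA : Set (Judg A)) (TB : Set (Judg B)) (b : Bool)
    (X : PreCtx A) (Y : PreCtx B) (Z : PreCtx (A.tensor B)) : Prop :=
  Z.length = X.length * Y.length ∧
  ∀ i j (hi : i < X.length) (hj : j < Y.length) (h : i * Y.length + j < Z.length),
    (Z[i * Y.length + j]'h).1 = ((X[i]'hi).1, (Y[j]'hj).1) ∧
    TSo TA TB b (X.take i) (X[i]'hi).1 (X[i]'hi).2
      (Y.take j) (Y[j]'hj).1 (Y[j]'hj).2 (Z[i * Y.length + j]'h).2

/-- The graph of the tensor operation `⊙` on pairs of judgments of the admissible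
kinds of Table 1 (flag `false`), resp. of the interchanged operation `⊙*` of §8
(flag `true`).  `chA` and `chB` are the functions choosing, for each context, a
variable not occurring in it. -/
inductive TJudg (TA : Set (Judg A)) (TB : Set (Judg B))
    (chA : PreCtx A → A.Var) (chB : PreCtx B → B.Var) :
    Bool → Judg A → Judg B → Judg (A.tensor B) → Prop where
  /- sort ⊙ sort -/
  | ss {b : Bool} {X : PreCtx A} {U : SortE A} {Y : PreCtx B} {V : SortE B}
      {Z : PreCtx (A.tensor B)} {W : SortE (A.tensor B)}
      (hZ : TCtx TA TB b (X ++ [(chA X, U)]) (Y ++ [(chB Y, V)]) Z)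
      (hW : TSo TA TB b X (chA X) U Y (chB Y) V W) :
      TJudg TA TB chA chB b (.sort X U) (.sort Y V) (.sort Z.dropLast W)
  /- sort ⊙ term -/
  | st {b : Bool} {X : PreCtx A} {U : SortE A} {Y : PreCtx B} {v : Expr B} {V : SortE B}
      {Z : PreCtx (A.tensor B)} {e : Expr (A.tensor B)} {W : SortE (A.tensor B)}
      {g : ℕ → Expr (A.tensor B)}
      (hZ : TCtx TA TB b (X ++ [(chA X, U)]) Y Z)
      (he : TTg TA TB b ⟨X, .var (chA X), U⟩ ⟨Y, v, V⟩ e)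
      (hW : TSo TA TB b X (chA X) U Y (chB Y) V W)
      (hg : ∀ i (hi : i < X.length),
          TTg TA TB b ⟨X.take i, .var (X[i]'hi).1, (X[i]'hi).2⟩ ⟨Y, v, V⟩ (g i)) :
      TJudg TA TB chA chB b (.sort X U) (.term Y v V)
        (.term Z e (W.substL (pairsL X (chB Y) g)))
  /- term ⊙ sort -/
  | ts {b : Bool} {X : PreCtx A} {u : Expr A} {U : SortE A} {Y : PreCtx B} {V : SortE B}
      {Z : PreCtx (A.tensor B)} {e : Expr (A.tensor B)} {W : SortE (A.tensor B)}
      {g : ℕ → Expr (A.tensor B)}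
      (hZ : TCtx TA TB b X (Y ++ [(chB Y, V)]) Z)
      (he : TTg TA TB b ⟨X, u, U⟩ ⟨Y, .var (chB Y), V⟩ e)
      (hW : TSo TA TB b X (chA X) U Y (chB Y) V W)
      (hg : ∀ j (hj : j < Y.length),
          TTg TA TB b ⟨X, u, U⟩ ⟨Y.take j, .var (Y[j]'hj).1, (Y[j]'hj).2⟩ (g j)) :
      TJudg TA TB chA chB b (.term X u U) (.sort Y V)
        (.term Z e (W.substL (pairsR (chA X) Y g)))
  /- term ⊙ term -/
  | tt {b : Bool} {X : PreCtx A} {u : Expr A} {U : SortE A}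
      {Y : PreCtx B} {v : Expr B} {V : SortE B}
      {Z : PreCtx (A.tensor B)} {e1 e2 : Expr (A.tensor B)} {W : SortE (A.tensor B)}
      {gx gy : ℕ → Expr (A.tensor B)}
      (hZ : TCtx TA TB b X Y Z)
      (he1 : TTg TA TB b ⟨X, u, U⟩ ⟨Y, v, V⟩ e1)
      (he2 : TTd TA TB b ⟨X, u, U⟩ ⟨Y, v, V⟩ e2)
      (hW : TSo TA TB b X (chA X) U Y (chB Y) V W)
      (hgx : ∀ i (hi : i < X.length),
          TTg TA TB b ⟨X.take i, .var (X[i]'hi).1, (X[i]'hi).2⟩ ⟨Y, v, V⟩ (gx i))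
      (hgy : ∀ j (hj : j < Y.length),
          TTg TA TB b ⟨X, u, U⟩ ⟨Y.take j, .var (Y[j]'hj).1, (Y[j]'hj).2⟩ (gy j)) :
      TJudg TA TB chA chB b (.term X u U) (.term Y v V)
        (.termEq Z e1 e2 (W.substL (pairsL X (chB Y) gx ++ pairsR (chA X) Y gy)))
  /- sort ⊙ sort equality -/
  | sseq {b : Bool} {X : PreCtx A} {U : SortE A} {Y : PreCtx B} {V V' : SortE B}
      {Z : PreCtx (A.tensor B)} {W W' : SortE (A.tensor B)}
      (hZ : TCtx TA TB b (X ++ [(chA X, U)]) (Y ++ [(chB Y, V)]) Z)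
      (hW : TSo TA TB b X (chA X) U Y (chB Y) V W)
      (hW' : TSo TA TB b X (chA X) U Y (chB Y) V' W') :
      TJudg TA TB chA chB b (.sort X U) (.sortEq Y V V') (.sortEq Z.dropLast W W')
  /- sort equality ⊙ sort -/
  | seqs {b : Bool} {X : PreCtx A} {U U' : SortE A} {Y : PreCtx B} {V : SortE B}
      {Z : PreCtx (A.tensor B)} {W W' : SortE (A.tensor B)}
      (hZ : TCtx TA TB b (X ++ [(chA X, U)]) (Y ++ [(chB Y, V)]) Z)
      (hW : TSo TA TB b X (chA X) U Y (chB Y) V W)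
      (hW' : TSo TA TB b X (chA X) U' Y (chB Y) V W') :
      TJudg TA TB chA chB b (.sortEq X U U') (.sort Y V) (.sortEq Z.dropLast W W')
  /- sort ⊙ term equality -/
  | steq {b : Bool} {X : PreCtx A} {U : SortE A} {Y : PreCtx B} {v v' : Expr B}
      {V : SortE B} {Z : PreCtx (A.tensor B)} {e e' : Expr (A.tensor B)}
      {W : SortE (A.tensor B)} {g : ℕ → Expr (A.tensor B)}
      (hZ : TCtx TA TB b (X ++ [(chA X, U)]) Y Z)
      (he : TTg TA TB b ⟨X, .var (chA X), U⟩ ⟨Y, v, V⟩ e)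
      (he' : TTg TA TB b ⟨X, .var (chA X), U⟩ ⟨Y, v', V⟩ e')
      (hW : TSo TA TB b X (chA X) U Y (chB Y) V W)
      (hg : ∀ i (hi : i < X.length),
          TTg TA TB b ⟨X.take i, .var (X[i]'hi).1, (X[i]'hi).2⟩ ⟨Y, v, V⟩ (g i)) :
      TJudg TA TB chA chB b (.sort X U) (.termEq Y v v' V)
        (.termEq Z e e' (W.substL (pairsL X (chB Y) g)))
  /- term equality ⊙ sort -/
  | teqs {b : Bool} {X : PreCtx A} {u u' : Expr A} {U : SortE A} {Y : PreCtx B}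
      {V : SortE B} {Z : PreCtx (A.tensor B)} {e e' : Expr (A.tensor B)}
      {W : SortE (A.tensor B)} {g : ℕ → Expr (A.tensor B)}
      (hZ : TCtx TA TB b X (Y ++ [(chB Y, V)]) Z)
      (he : TTg TA TB b ⟨X, u, U⟩ ⟨Y, .var (chB Y), V⟩ e)
      (he' : TTg TA TB b ⟨X, u', U⟩ ⟨Y, .var (chB Y), V⟩ e')
      (hW : TSo TA TB b X (chA X) U Y (chB Y) V W)
      (hg : ∀ j (hj : j < Y.length),
          TTg TA TB b ⟨X, u, U⟩ ⟨Y.take j, .var (Y[j]'hj).1, (Y[j]'hj).2⟩ (g j)) :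
      TJudg TA TB chA chB b (.termEq X u u' U) (.sort Y V)
        (.termEq Z e e' (W.substL (pairsR (chA X) Y g)))
  /- sort equality ⊙ term -/
  | seqt {b : Bool} {X : PreCtx A} {U U' : SortE A} {Y : PreCtx B} {v : Expr B}
      {V : SortE B} {Z : PreCtx (A.tensor B)} {e e' : Expr (A.tensor B)}
      {W : SortE (A.tensor B)} {g : ℕ → Expr (A.tensor B)}
      (hZ : TCtx TA TB b (X ++ [(chA X, U)]) Y Z)
      (he : TTg TA TB b ⟨X, .var (chA X), U⟩ ⟨Y, v, V⟩ e)
      (he' : TTg TA TB b ⟨X, .var (chA X), U'⟩ ⟨Y, v, V⟩ e')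
      (hW : TSo TA TB b X (chA X) U Y (chB Y) V W)
      (hg : ∀ i (hi : i < X.length),
          TTg TA TB b ⟨X.take i, .var (X[i]'hi).1, (X[i]'hi).2⟩ ⟨Y, v, V⟩ (g i)) :
      TJudg TA TB chA chB b (.sortEq X U U') (.term Y v V)
        (.termEq Z e e' (W.substL (pairsL X (chB Y) g)))
  /- term ⊙ sort equality -/
  | tseq {b : Bool} {X : PreCtx A} {u : Expr A} {U : SortE A} {Y : PreCtx B}
      {V V' : SortE B} {Z : PreCtx (A.tensor B)} {e e' : Expr (A.tensor B)}
      {W : SortE (A.tensor B)} {g : ℕ → Expr (A.tensor B)}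
      (hZ : TCtx TA TB b X (Y ++ [(chB Y, V)]) Z)
      (he : TTg TA TB b ⟨X, u, U⟩ ⟨Y, .var (chB Y), V⟩ e)
      (he' : TTg TA TB b ⟨X, u, U⟩ ⟨Y, .var (chB Y), V'⟩ e')
      (hW : TSo TA TB b X (chA X) U Y (chB Y) V W)
      (hg : ∀ j (hj : j < Y.length),
          TTg TA TB b ⟨X, u, U⟩ ⟨Y.take j, .var (Y[j]'hj).1, (Y[j]'hj).2⟩ (g j)) :
      TJudg TA TB chA chB b (.term X u U) (.sortEq Y V V')
        (.termEq Z e e' (W.substL (pairsR (chA X) Y g)))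

/-- A choice, for every precontext, of a variable not contained in it. -/
def FreshCh {A : Alphabet} (ch : PreCtx A → A.Var) : Prop :=
  ∀ X : PreCtx A, ∀ p ∈ X, p.1 ≠ ch X

/-- The set of axioms of the pretheory `𝔸 ⊗ 𝔹`: the judgments `J ⊙ J'` for `J` an
axiom of `𝔸` and `J'` an axiom of `𝔹`. -/
def tensorAx (TA : Set (Judg A)) (TB : Set (Judg B))
    (chA : PreCtx A → A.Var) (chB : PreCtx B → B.Var) : Set (Judg (A.tensor B)) :=
  {K | ∃ J J', J ∈ TA ∧ J' ∈ TB ∧ TJudg TA TB chA chB false J J' K}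

/-- The pair `(𝔸, 𝔹)` is `h`-derivable: `J ⊙ J'` is derivable in the pretheory
`𝔸 ⊗ 𝔹` whenever `J`, `J'` are derivable judgments of `𝔸`, `𝔹` (of admissible
kinds) with `ht J * ht J' ≤ h`. -/
def hDerivable (TA : Set (Judg A)) (TB : Set (Judg B))
    (chA : PreCtx A → A.Var) (chB : PreCtx B → B.Var) (h : ℕ) : Prop :=
  ∀ (J : Judg A) (J' : Judg B) (K : Judg (A.tensor B)),
    Derivable TA J → Derivable TB J' → ht TA J * ht TB J' ≤ h →
    TJudg TA TB chA chB false J J' K → Derivable (tensorAx TA TB chA chB) K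

/-- The tensor `out = f ⊗ g` of two tuples of derivable terms, each entry being
the tensor of terms taken at their canonical sorts, ordered lexicographically. -/
def TMor (TA : Set (Judg A)) (TB : Set (Judg B)) (b : Bool)
    (X : PreCtx A) (f : List (Expr A)) (Y : PreCtx B) (g : List (Expr B))
    (out : List (Expr (A.tensor B))) : Prop :=
  out.length = f.length * g.length ∧
  ∀ i j (hi : i < f.length) (hj : j < g.length) (h : i * g.length + j < out.length),
    ∃ U V, CanonSort TA X (f[i]'hi) U ∧ CanonSort TB Y (g[j]'hj) V ∧
      TTg TA TB b ⟨X, f[i]'hi, U⟩ ⟨Y, g[j]'hj, V⟩ (out[i * g.length + j]'h)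

/-- The tensor `out = f ⊗ Y` of a tuple of derivable terms of `𝔸` with a context
of `𝔹`: entries `fᵢ^{𝒮(fᵢ)} ⊗ yⱼ^{Yⱼ}`. -/
def TMorCtx (TA : Set (Judg A)) (TB : Set (Judg B)) (b : Bool)
    (X : PreCtx A) (f : List (Expr A)) (Y : PreCtx B)
    (out : List (Expr (A.tensor B))) : Prop :=
  out.length = f.length * Y.length ∧
  ∀ i j (hi : i < f.length) (hj : j < Y.length) (h : i * Y.length + j < out.length),
    ∃ U, CanonSort TA X (f[i]'hi) U ∧
      TTg TA TB b ⟨X, f[i]'hi, U⟩ ⟨Y.take j, .var (Y[j]'hj).1, (Y[j]'hj).2⟩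
        (out[i * Y.length + j]'h)

/-- The tensor `out = X ⊗ g` of a context of `𝔸` with a tuple of derivable terms
of `𝔹`: entries `xᵢ^{Xᵢ} ⊗ gⱼ^{𝒮(gⱼ)}`. -/
def TCtxMor (TA : Set (Judg A)) (TB : Set (Judg B)) (b : Bool)
    (X : PreCtx A) (Y : PreCtx B) (g : List (Expr B))
    (out : List (Expr (A.tensor B))) : Prop :=
  out.length = X.length * g.length ∧
  ∀ i j (hi : i < X.length) (hj : j < g.length) (h : i * g.length + j < out.length),
    ∃ V, CanonSort TB Y (g[j]'hj) V ∧
      TTg TA TB b ⟨X.take i, .var (X[i]'hi).1, (X[i]'hi).2⟩ ⟨Y, g[j]'hj, V⟩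
        (out[i * g.length + j]'h)

/-- The tensor `out = (x₁,…,x_m,u^U) ⊗ Y` of the section determined by a term
`X ⊢ u : U` with a context of `𝔹`. -/
def TSecL (TA : Set (Judg A)) (TB : Set (Judg B)) (b : Bool)
    (X : PreCtx A) (u : Expr A) (U : SortE A) (Y : PreCtx B)
    (out : List (Expr (A.tensor B))) : Prop :=
  out.length = (X.length + 1) * Y.length ∧
  (∀ i j (hi : i < X.length) (hj : j < Y.length) (h : i * Y.length + j < out.length),
      TTg TA TB b ⟨X.take i, .var (X[i]'hi).1, (X[i]'hi).2⟩
        ⟨Y.take j, .var (Y[j]'hj).1, (Y[j]'hj).2⟩ (out[i * Y.length + j]'h)) ∧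
  (∀ j (hj : j < Y.length) (h : X.length * Y.length + j < out.length),
      TTg TA TB b ⟨X, u, U⟩ ⟨Y.take j, .var (Y[j]'hj).1, (Y[j]'hj).2⟩
        (out[X.length * Y.length + j]'h))

/-- The tensor `out = X ⊗ (y₁,…,yₙ,v^V)` of a context of `𝔸` with the section
determined by a term `Y ⊢ v : V` of `𝔹`. -/
def TSecR (TA : Set (Judg A)) (TB : Set (Judg B)) (b : Bool)
    (X : PreCtx A) (Y : PreCtx B) (v : Expr B) (V : SortE B)
    (out : List (Expr (A.tensor B))) : Prop :=
  out.length = X.length * (Y.length + 1) ∧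
  (∀ i j (hi : i < X.length) (hj : j < Y.length)
      (h : i * (Y.length + 1) + j < out.length),
      TTg TA TB b ⟨X.take i, .var (X[i]'hi).1, (X[i]'hi).2⟩
        ⟨Y.take j, .var (Y[j]'hj).1, (Y[j]'hj).2⟩ (out[i * (Y.length + 1) + j]'h)) ∧
  (∀ i (hi : i < X.length) (h : i * (Y.length + 1) + Y.length < out.length),
      TTg TA TB b ⟨X.take i, .var (X[i]'hi).1, (X[i]'hi).2⟩ ⟨Y, v, V⟩
        (out[i * (Y.length + 1) + Y.length]'h))


/-! ## Substitution calculus -/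

theorem Expr.subst_var (σ : A.Var → Expr A) (x : A.Var) : (Expr.var x).subst σ = σ x := by
  rw [Expr.subst]

theorem Expr.subst_app (σ : A.Var → Expr A) (t : A.TermSym) (es : List (Expr A)) :
    (Expr.app t es).subst σ = .app t (es.map (Expr.subst σ)) := by
  rw [Expr.subst]
  simp

theorem Expr.induction_args {motive : Expr A → Prop} (var : ∀ x, motive (.var x))
    (app : ∀ t es, (∀ e ∈ es, motive e) → motive (.app t es)) : ∀ e, motive e
  | .var x => var x
  | .app t es => app t es fun e he => Expr.induction_args var app e
termination_by e => sizeOf e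
decreasing_by
  have := List.sizeOf_lt_of_mem he
  simp only [Expr.app.sizeOf_spec]
  omega

theorem occurs_var_iff {x y : A.Var} : Occurs x (.var y) ↔ x = y :=
  ⟨fun h => by cases h; rfl, fun h => h ▸ .var⟩

theorem occurs_app_iff {x : A.Var} {t : A.TermSym} {es : List (Expr A)} :
    Occurs x (.app t es) ↔ ∃ e ∈ es, Occurs x e :=
  ⟨fun h => by cases h with | app h1 h2 => exact ⟨_, h1, h2⟩, fun ⟨_, h1, h2⟩ => .app h1 h2⟩

theorem Expr.subst_congr {σ τ : A.Var → Expr A} {e : Expr A}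
    (h : ∀ x, Occurs x e → σ x = τ x) : e.subst σ = e.subst τ := by
  induction e using Expr.induction_args with
  | var x => simpa [Expr.subst_var] using h x .var
  | app t es ih =>
    rw [Expr.subst_app, Expr.subst_app]
    congr 1
    exact List.map_congr_left fun e he => ih e he fun x hx => h x (.app he hx)

theorem Expr.subst_subst (σ τ : A.Var → Expr A) (e : Expr A) :
    (e.subst σ).subst τ = e.subst fun x => (σ x).subst τ := by
  induction e using Expr.induction_args with
  | var x => simp [Expr.subst_var]
  | app t es ih =>
    simp only [Expr.subst_app, List.map_map]
    congr 1
    exact List.map_congr_left fun e he => ih e he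

theorem Expr.subst_id (e : Expr A) : e.subst .var = e := by
  induction e using Expr.induction_args with
  | var x => simp [Expr.subst_var]
  | app t es ih =>
    rw [Expr.subst_app]
    congr 1
    exact (List.map_congr_left ih).trans (List.map_id es)

theorem Expr.subst_eq_self {σ : A.Var → Expr A} {e : Expr A}
    (h : ∀ x, Occurs x e → σ x = .var x) : e.subst σ = e :=
  (Expr.subst_congr h).trans e.subst_id

theorem occurs_subst {σ : A.Var → Expr A} {e : Expr A} {y : A.Var} (h : Occurs y (e.subst σ)) :
    ∃ x, Occurs x e ∧ Occurs y (σ x) := by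
  induction e using Expr.induction_args with
  | var x => exact ⟨x, .var, by simpa [Expr.subst_var] using h⟩
  | app t es ih =>
    rw [Expr.subst_app, occurs_app_iff] at h
    obtain ⟨e', he', hy⟩ := h
    obtain ⟨e, he, rfl⟩ := List.mem_map.1 he'
    obtain ⟨x, hx, hy⟩ := ih e he hy
    exact ⟨x, .app he hx, hy⟩

theorem SortE.subst_congr {σ τ : A.Var → Expr A} {U : SortE A}
    (h : ∀ x, SOccurs x U → σ x = τ x) : U.subst σ = U.subst τ := by
  unfold SortE.subst
  congr 1
  exact List.map_congr_left fun e he => Expr.subst_congr fun x hx => h x ⟨e, he, hx⟩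

theorem SortE.subst_subst (σ τ : A.Var → Expr A) (U : SortE A) :
    (U.subst σ).subst τ = U.subst fun x => (σ x).subst τ := by
  simp only [SortE.subst, List.map_map]
  congr 1
  exact List.map_congr_left fun e he => Expr.subst_subst σ τ e

theorem SortE.subst_eq_self {σ : A.Var → Expr A} {U : SortE A}
    (h : ∀ x, SOccurs x U → σ x = .var x) : U.subst σ = U := by
  obtain ⟨S, ss⟩ := U
  simp only [SortE.subst]
  congr 1
  exact (List.map_congr_left fun e he =>
    Expr.subst_eq_self fun x hx => h x ⟨e, he, hx⟩).trans (List.map_id ss)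

theorem SortE.subst_id (U : SortE A) : U.subst .var = U := SortE.subst_eq_self fun _ _ => rfl

/-! ## Lookup in substitution lists -/

theorem lookupV_eq_of_mem {ps : List (A.Var × Expr A)} (hn : (ps.map Prod.fst).Nodup)
    {x : A.Var} {e : Expr A} (h : (x, e) ∈ ps) : lookupV ps x = e := by
  induction ps with
  | nil => simp at h
  | cons p ps ih =>
    simp only [List.map_cons, List.nodup_cons] at hn
    rcases List.mem_cons.1 h with rfl | h
    · simp [lookupV]
    · have : p.1 ≠ x := fun hp => hn.1 (hp ▸ List.mem_map.2 ⟨_, h, rfl⟩)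
      simp [lookupV, this, ih hn.2 h]

theorem lookupV_eq_var {ps : List (A.Var × Expr A)} {x : A.Var}
    (h : ∀ p ∈ ps, p.1 ≠ x) : lookupV ps x = .var x := by
  induction ps with
  | nil => rfl
  | cons p ps ih =>
    simp [lookupV, h p (by simp), ih fun q hq => h q (by simp [hq])]

theorem lookupV_mem {ps : List (A.Var × Expr A)} {x : A.Var} (h : x ∈ ps.map Prod.fst) :
    (x, lookupV ps x) ∈ ps := by
  induction ps with
  | nil => simp at h
  | cons p ps ih =>
    by_cases hp : p.1 = x
    · subst hp
      simp [lookupV]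
    · have hx : x ∈ ps.map Prod.fst := by
        simpa [Ne.symm hp] using h
      simp only [lookupV, if_neg hp]
      exact List.mem_cons_of_mem _ (ih hx)

theorem map_fst_mkSub {X : PreCtx A} {f : List (Expr A)} (h : X.length ≤ f.length) :
    (mkSub X f).map Prod.fst = X.map Prod.fst := by
  unfold mkSub
  rw [List.map_fst_zip]
  simpa using h

theorem lookupV_mkSub_map (θ : A.Var → Expr A) {X : PreCtx A} {v : A.Var}
    (hv : v ∈ X.map Prod.fst) : lookupV (mkSub X (X.map fun p => θ p.1)) v = θ v := by
  have h := lookupV_mem (ps := mkSub X (X.map fun p => θ p.1)) (x := v)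
    (by rwa [map_fst_mkSub (by simp)])
  obtain ⟨i, hi, hp⟩ := List.getElem_of_mem h
  simp only [mkSub, List.getElem_zip, List.getElem_map, Prod.mk.injEq] at hp
  exact hp.2.symm.trans (congrArg θ hp.1)

theorem lookupV_mkSub_subst (θ : A.Var → Expr A) {X : PreCtx A} {f : List (Expr A)}
    {v : A.Var} (hv : v ∈ X.map Prod.fst) (hf : X.length ≤ f.length) :
    (lookupV (mkSub X f) v).subst θ = lookupV (mkSub X (f.map (Expr.subst θ))) v := by
  induction X generalizing f with
  | nil => simp at hv
  | cons p X ih =>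
    cases f with
    | nil => simp at hf
    | cons e f =>
      by_cases hp : p.1 = v
      · simp [mkSub, lookupV, hp]
      · have := ih (f := f) (by simpa [Ne.symm hp] using hv) (by simpa using hf)
        simpa [mkSub, lookupV, hp] using this

theorem lookupV_mkSub_mem {X : PreCtx A} {f : List (Expr A)}
    {v : A.Var} (hv : v ∈ X.map Prod.fst) (hf : X.length ≤ f.length) :
    lookupV (mkSub X f) v ∈ f :=
  (List.of_mem_zip (lookupV_mem (ps := mkSub X f) (by rwa [map_fst_mkSub hf]))).2

theorem lookupV_mkSub_getElem {X : PreCtx A} {f : List (Expr A)} (hn : (X.map Prod.fst).Nodup)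
    (hf : X.length = f.length) {i : ℕ} (hi : i < X.length) :
    lookupV (mkSub X f) (X[i]).1 = f[i] := by
  refine lookupV_eq_of_mem (by rwa [map_fst_mkSub hf.le]) ?_
  refine List.mem_iff_getElem.2 ⟨i, by simp [mkSub, hf.symm ▸ hi]; omega, by simp [mkSub]⟩

/-! ## Well-formed expressions -/

/-- The variables declared in a precontext. -/
def InCtx (X : PreCtx A) (v : A.Var) : Prop := v ∈ X.map Prod.fst

/-- Term expressions all of whose variables satisfy `P` and whose term symbols are
applied to as many arguments as some introducing axiom prescribes. -/
inductive WFExpr (Ax : Set (Judg A)) (P : A.Var → Prop) : Expr A → Prop where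
  | var {x : A.Var} (hx : P x) : WFExpr Ax P (.var x)
  | app {t : A.TermSym} {f : List (Expr A)} {Xa : PreCtx A} {U : SortE A}
      (hax : introTerm Xa t U ∈ Ax) (hlen : f.length = Xa.length)
      (hargs : ∀ e ∈ f, WFExpr Ax P e) : WFExpr Ax P (.app t f)

/-- Sort expressions with well-formed arguments. -/
def WFSort (Ax : Set (Judg A)) (P : A.Var → Prop) (U : SortE A) : Prop :=
  ∀ e ∈ U.args, WFExpr Ax P e

theorem WFExpr.occurs {Ax : Set (Judg A)} {P : A.Var → Prop} {e : Expr A} (h : WFExpr Ax P e)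
    {x : A.Var} (hx : Occurs x e) : P x := by
  induction h with
  | var h => exact occurs_var_iff.1 hx ▸ h
  | app _ _ _ ih =>
    obtain ⟨e, he, hx⟩ := occurs_app_iff.1 hx
    exact ih e he hx

theorem WFSort.occurs {Ax : Set (Judg A)} {P : A.Var → Prop} {U : SortE A} (h : WFSort Ax P U)
    {x : A.Var} (hx : SOccurs x U) : P x :=
  let ⟨e, he, hx⟩ := hx
  (h e he).occurs hx

theorem WFExpr.subst {Ax : Set (Judg A)} {P Q : A.Var → Prop} {e : Expr A} {σ : A.Var → Expr A}
    (h : WFExpr Ax P e) (hσ : ∀ x, P x → WFExpr Ax Q (σ x)) : WFExpr Ax Q (e.subst σ) := by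
  induction h with
  | var h => simpa [Expr.subst_var] using hσ _ h
  | app hax hlen _ ih =>
    rw [Expr.subst_app]
    refine .app hax (by simpa using hlen) fun e' he' => ?_
    obtain ⟨e, he, rfl⟩ := List.mem_map.1 he'
    exact ih e he

theorem WFSort.subst {Ax : Set (Judg A)} {P Q : A.Var → Prop} {U : SortE A}
    {σ : A.Var → Expr A} (h : WFSort Ax P U) (hσ : ∀ x, P x → WFExpr Ax Q (σ x)) :
    WFSort Ax Q (U.subst σ) := fun e' he' => by
  obtain ⟨e, he, rfl⟩ := List.mem_map.1 he'
  exact (h e he).subst hσ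

theorem WFSort.mono {Ax : Set (Judg A)} {P Q : A.Var → Prop} {U : SortE A}
    (h : WFSort Ax P U) (hPQ : ∀ x, P x → Q x) : WFSort Ax Q U := by
  simpa [SortE.subst_id] using h.subst (σ := .var) fun x hx => .var (hPQ x hx)

/-- Precontexts with distinct variables and well-formed sorts, each in its initial segment. -/
structure GoodCtx (Ax : Set (Judg A)) (X : PreCtx A) : Prop where
  nodup : (X.map Prod.fst).Nodup
  sorts : ∀ i (hi : i < X.length), WFSort Ax (InCtx (X.take i)) (X[i]).2

theorem GoodCtx.isPreCtx {Ax : Set (Judg A)} {X : PreCtx A} (h : GoodCtx Ax X) : IsPreCtx X :=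
  fun i hi _ hv => (h.sorts i hi).occurs hv

theorem GoodCtx.take {Ax : Set (Judg A)} {X : PreCtx A} (h : GoodCtx Ax X) (n : ℕ) :
    GoodCtx Ax (X.take n) where
  nodup := h.nodup.sublist ((List.take_sublist n X).map _)
  sorts i hi := by
    have hi' : i < n ∧ i < X.length := by simpa using hi
    have := h.sorts i hi'.2
    simpa [List.take_take, hi'.1.le] using this

theorem inCtx_of_take {X : PreCtx A} {n : ℕ} {v : A.Var} (h : InCtx (X.take n) v) :
    InCtx X v :=
  ((List.take_sublist n X).map _).subset h

theorem inCtx_iff {X : PreCtx A} {v : A.Var} :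
    InCtx X v ↔ ∃ i, ∃ hi : i < X.length, (X[i]).1 = v := by
  simp [InCtx, List.mem_iff_getElem, List.getElem_map]

theorem inCtx_getElem {X : PreCtx A} {i : ℕ} (hi : i < X.length) : InCtx X (X[i]).1 :=
  inCtx_iff.2 ⟨i, hi, rfl⟩

theorem inCtx_take_iff {X : PreCtx A} {n : ℕ} {v : A.Var} :
    InCtx (X.take n) v ↔ ∃ i, ∃ hi : i < X.length, i < n ∧ (X[i]).1 = v := by
  rw [inCtx_iff]
  constructor
  · rintro ⟨i, hi, h⟩
    have hi' : i < n ∧ i < X.length := by simpa using hi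
    exact ⟨i, hi'.2, hi'.1, by simpa using h⟩
  · rintro ⟨i, hi, hn, h⟩
    exact ⟨i, by simp [hn, hi], by simpa using h⟩

theorem GoodCtx.index_inj {Ax : Set (Judg A)} {X : PreCtx A} (h : GoodCtx Ax X) {i j : ℕ}
    (hi : i < X.length) (hj : j < X.length) (hij : (X[i]).1 = (X[j]).1) : i = j :=
  (h.nodup.getElem_inj_iff (i := i) (j := j) (hi := by simpa using hi)
    (hj := by simpa using hj)).1 (by simpa using hij)

theorem GoodCtx.not_inCtx_take {Ax : Set (Judg A)} {X : PreCtx A} (h : GoodCtx Ax X) {i : ℕ}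
    (hi : i < X.length) : ¬ InCtx (X.take i) (X[i]).1 := fun hx => by
  obtain ⟨j, hj, hji, hv⟩ := inCtx_take_iff.1 hx
  exact hji.ne (h.index_inj hj hi hv)

theorem GoodCtx.append {Ax : Set (Judg A)} {X : PreCtx A} (h : GoodCtx Ax X) {x : A.Var}
    {U : SortE A} (hx : ∀ p ∈ X, p.1 ≠ x) (hU : WFSort Ax (InCtx X) U) :
    GoodCtx Ax (X ++ [(x, U)]) where
  nodup := by
    rw [List.map_append, List.nodup_append]
    refine ⟨h.nodup, by simp, ?_⟩
    simpa using fun a V ha => hx (a, V) ha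
  sorts i hi := by
    have hi' : i < X.length ∨ i = X.length := by
      simp at hi; omega
    rcases hi' with hi' | rfl
    · simpa [List.getElem_append_left hi', List.take_append_of_le_length hi'.le] using
        h.sorts i hi'
    · simpa using hU

/-- The part of being a pretheory that restricts the form of sort and term axioms. -/
structure Shape (Ax : Set (Judg A)) : Prop where
  sort : ∀ (X : PreCtx A) (U : SortE A), Judg.sort X U ∈ Ax → U.args = ctxVars X
  term : ∀ (X : PreCtx A) (u : Expr A) (U : SortE A), Judg.term X u U ∈ Ax →
      ∃ t : A.TermSym, u = Expr.app t (ctxVars X)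

theorem IsPretheory.shape {Ax : Set (Judg A)} (h : IsPretheory Ax) : Shape Ax :=
  ⟨h.sort_shape, h.term_shape⟩

theorem wfExpr_of_mem_ctxVars {Ax : Set (Judg A)} {X : PreCtx A} {e : Expr A}
    (h : e ∈ ctxVars X) : WFExpr Ax (InCtx X) e := by
  obtain ⟨p, hp, rfl⟩ := List.mem_map.1 h
  exact .var (List.mem_map.2 ⟨p, hp, rfl⟩)

/-! ## Derivability -/

/-- Well-formedness of all the data of a judgment. -/
def GoodJudg (Ax : Set (Judg A)) : Judg A → Prop
  | .ctx X => GoodCtx Ax X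
  | .sort X U => GoodCtx Ax X ∧ WFSort Ax (InCtx X) U
  | .term X u U => GoodCtx Ax X ∧ WFExpr Ax (InCtx X) u ∧ WFSort Ax (InCtx X) U
  | .sortEq X U V => GoodCtx Ax X ∧ WFSort Ax (InCtx X) U ∧ WFSort Ax (InCtx X) V
  | .termEq X u v U => GoodCtx Ax X ∧ WFExpr Ax (InCtx X) u ∧ WFExpr Ax (InCtx X) v ∧
      WFSort Ax (InCtx X) U

theorem Step.goodJudg {Ax : Set (Judg A)} (hs : Shape Ax) {J : Judg A}
    (h : Step Ax (GoodJudg Ax) J) : GoodJudg Ax J := by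
  have harg : ∀ {Y : PreCtx A} {f : List (Expr A)} {n : ℕ} {W : ∀ i, i < n → SortE A},
      f.length = n → (∀ i (hi : i < n) (hif : i < f.length),
        GoodJudg Ax (.term Y (f[i]'hif) (W i hi))) → ∀ e ∈ f, WFExpr Ax (InCtx Y) e := by
    intro Y f n W hl h e he
    obtain ⟨i, hi, rfl⟩ := List.getElem_of_mem he
    exact (h i (hl ▸ hi) hi).2.1
  cases h with
  | ctx_nil => exact ⟨by simp, by simp⟩
  | ctx_cons hs hf _ => exact hs.1.append hf hs.2
  | s1 h => exact ⟨h.1, h.2, h.2⟩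
  | s2 h => exact ⟨h.1, h.2.2, h.2.1⟩
  | s3 h1 h2 => exact ⟨h1.1, h1.2.1, h2.2.2⟩
  | t1 h => exact ⟨h.1, h.2.1, h.2.1, h.2.2⟩
  | t2 h => exact ⟨h.1, h.2.2.1, h.2.1, h.2.2.2⟩
  | t3 h1 h2 => exact ⟨h1.1, h1.2.1, h2.2.2.1, h1.2.2.2⟩
  | seqt h1 h2 => exact ⟨h1.1, h2.2.1, h1.2.2⟩
  | seqteq h1 h2 h3 h4 => exact ⟨h1.1, h3.2.1, h4.2.1, h1.2.2⟩
  | var hi h => exact ⟨h.1, .var (inCtx_getElem hi), h.2⟩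
  | sA hax h hv =>
    exact ⟨h, fun e he => wfExpr_of_mem_ctxVars (hs.sort _ _ hax ▸ he)⟩
  | @tA X u U hax h hv =>
    obtain ⟨t, rfl⟩ := hs.term _ _ _ hax
    exact ⟨h.1, .app hax (by simp [ctxVars]) fun e he => wfExpr_of_mem_ctxVars he, h.2⟩
  | seqA hax h1 h2 => exact ⟨h1.1, h1.2, h2.2⟩
  | teqA hax h1 h2 => exact ⟨h1.1, h1.2.1, h2.2.1, h1.2.2⟩
  | sSub hax hY hlen hJ hYc hargs => exact ⟨hYc, harg hlen hargs⟩
  | tSub hax hY hlen hJ hU hargs => exact ⟨hU.1, .app hax hlen (harg hlen hargs), hU.2⟩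
  | seqSub1 hax hY hlen hJ h1 h2 hargs => exact ⟨h1.1, h1.2, h2.2⟩
  | seqSub2 hax hY hlf hlg hJ h1 h2 hargs => exact ⟨h1.1, h1.2, h2.2⟩
  | teqSub1 hax hY hlen hJ h1 h2 hargs => exact ⟨h1.1, h1.2.1, h2.2.1, h1.2.2⟩
  | teqSub2 hax hY hlf hlg hJ h1 h2 hargs => exact ⟨h1.1, h1.2.1, h2.2.1, h1.2.2⟩

theorem Step.mono {Ax : Set (Judg A)} {D D' : Judg A → Prop} (hD : ∀ J, D J → D' J) {J : Judg A}
    (h : Step Ax D J) : Step Ax D' J := by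
  cases h with
  | ctx_nil => exact .ctx_nil
  | ctx_cons hs hf hp => exact .ctx_cons (hD _ hs) hf hp
  | s1 h => exact .s1 (hD _ h)
  | s2 h => exact .s2 (hD _ h)
  | s3 h1 h2 => exact .s3 (hD _ h1) (hD _ h2)
  | t1 h => exact .t1 (hD _ h)
  | t2 h => exact .t2 (hD _ h)
  | t3 h1 h2 => exact .t3 (hD _ h1) (hD _ h2)
  | seqt h1 h2 => exact .seqt (hD _ h1) (hD _ h2)
  | seqteq h1 h2 h3 h4 => exact .seqteq (hD _ h1) (hD _ h2) (hD _ h3) (hD _ h4)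
  | var hi h => exact .var hi (hD _ h)
  | sA hax h hv => exact .sA hax (hD _ h) fun i hi => hD _ (hv i hi)
  | tA hax h hv => exact .tA hax (hD _ h) fun i hi => hD _ (hv i hi)
  | seqA hax h1 h2 => exact .seqA hax (hD _ h1) (hD _ h2)
  | teqA hax h1 h2 => exact .teqA hax (hD _ h1) (hD _ h2)
  | sSub hax hY hlen hJ hYc hargs =>
    exact .sSub hax hY hlen (hD _ hJ) (hD _ hYc) fun i hi hif => hD _ (hargs i hi hif)
  | tSub hax hY hlen hJ hU hargs =>
    exact .tSub hax hY hlen (hD _ hJ) (hD _ hU) fun i hi hif => hD _ (hargs i hi hif)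
  | seqSub1 hax hY hlen hJ h1 h2 hargs =>
    exact .seqSub1 hax hY hlen (hD _ hJ) (hD _ h1) (hD _ h2)
      fun i hi hif => hD _ (hargs i hi hif)
  | seqSub2 hax hY hlf hlg hJ h1 h2 hargs =>
    exact .seqSub2 hax hY hlf hlg (hD _ hJ) (hD _ h1) (hD _ h2)
      fun i hi hif hig => hD _ (hargs i hi hif hig)
  | teqSub1 hax hY hlen hJ h1 h2 hargs =>
    exact .teqSub1 hax hY hlen (hD _ hJ) (hD _ h1) (hD _ h2)
      fun i hi hif => hD _ (hargs i hi hif)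
  | teqSub2 hax hY hlf hlg hJ h1 h2 hargs =>
    exact .teqSub2 hax hY hlf hlg (hD _ hJ) (hD _ h1) (hD _ h2)
      fun i hi hif hig => hD _ (hargs i hi hif hig)

theorem DerAt.mono {Ax : Set (Judg A)} {m n : ℕ} (hmn : m ≤ n) {J : Judg A}
    (h : DerAt Ax m J) : DerAt Ax n J := by
  induction hmn with
  | refl => exact h
  | step _ ih => exact Or.inl ih

theorem DerAt.exists_step {Ax : Set (Judg A)} {n : ℕ} {J : Judg A} (h : DerAt Ax n J) :
    ∃ m < n, Step Ax (DerAt Ax m) J := by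
  induction n with
  | zero => exact h.elim
  | succ n ih =>
    rcases h with h | h
    · obtain ⟨m, hm, h⟩ := ih h
      exact ⟨m, by omega, h⟩
    · exact ⟨n, by omega, h⟩

theorem DerAt.goodJudg {Ax : Set (Judg A)} (hs : Shape Ax) {n : ℕ} {J : Judg A}
    (h : DerAt Ax n J) : GoodJudg Ax J := by
  induction n generalizing J with
  | zero => exact h.elim
  | succ n ih =>
    rcases h with h | h
    · exact ih h
    · exact (h.mono fun _ => ih).goodJudg hs

theorem Derivable.goodJudg {Ax : Set (Judg A)} (hs : Shape Ax) {J : Judg A}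
    (h : Derivable Ax J) : GoodJudg Ax J :=
  let ⟨_, h⟩ := h
  h.goodJudg hs

/-- Finitely many derivable judgments appear at a common stage. -/
theorem exists_derAt_bound {Ax : Set (Judg A)} (L : List (Judg A))
    (h : ∀ J ∈ L, Derivable Ax J) : ∃ n, ∀ J ∈ L, DerAt Ax n J := by
  induction L with
  | nil => exact ⟨0, by simp⟩
  | cons J L ih =>
    obtain ⟨n, hn⟩ := ih fun J hJ => h J (by simp [hJ])
    obtain ⟨m, hm⟩ := h J (by simp)
    refine ⟨max m n, fun K hK => ?_⟩
    rcases List.mem_cons.1 hK with rfl | hK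
    · exact hm.mono (le_max_left _ _)
    · exact (hn K hK).mono (le_max_right _ _)

/-- An inference step only uses finitely many premises. -/
theorem Step.finite {Ax : Set (Judg A)} {D : Judg A → Prop} {J : Judg A} (h : Step Ax D J) :
    ∃ L : List (Judg A), (∀ K ∈ L, D K) ∧ Step Ax (· ∈ L) J := by
  have hfam : ∀ {n : ℕ} {K : ∀ i, i < n → Judg A}, (∀ i hi, D (K i hi)) →
      ∃ L : List (Judg A), (∀ K ∈ L, D K) ∧ ∀ i hi, K i hi ∈ L := by
    intro n K h
    refine ⟨(List.finRange n).map fun i => K i.1 i.2, fun J hJ => ?_, fun i hi => ?_⟩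
    · obtain ⟨i, -, rfl⟩ := List.mem_map.1 hJ
      exact h _ _
    · exact List.mem_map.2 ⟨⟨i, hi⟩, by simp, rfl⟩
  cases h with
  | ctx_nil => exact ⟨[], by simp, .ctx_nil⟩
  | ctx_cons hs hf hp => exact ⟨[_], by simpa using hs, .ctx_cons (by simp) hf hp⟩
  | s1 h => exact ⟨[_], by simpa using h, .s1 (by simp)⟩
  | s2 h => exact ⟨[_], by simpa using h, .s2 (by simp)⟩
  | s3 h1 h2 =>
    exact ⟨[_, _], by simpa using And.intro h1 h2, .s3 (List.mem_cons_self) (by simp)⟩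
  | t1 h => exact ⟨[_], by simpa using h, .t1 (by simp)⟩
  | t2 h => exact ⟨[_], by simpa using h, .t2 (by simp)⟩
  | t3 h1 h2 =>
    exact ⟨[_, _], by simpa using And.intro h1 h2, .t3 (List.mem_cons_self) (by simp)⟩
  | seqt h1 h2 =>
    exact ⟨[_, _], by simpa using And.intro h1 h2, .seqt (List.mem_cons_self) (by simp)⟩
  | seqteq h1 h2 h3 h4 =>
    exact ⟨[_, _, _, _], by simpa using And.intro h1 ⟨h2, h3, h4⟩,
      .seqteq (List.mem_cons_self) (by simp) (by simp) (by simp)⟩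
  | var hi h => exact ⟨[_], by simpa using h, .var hi (by simp)⟩
  | sA hax h hv =>
    obtain ⟨L, hL, hm⟩ := hfam hv
    exact ⟨_ :: L, List.forall_mem_cons.2 ⟨h, hL⟩,
      .sA hax (by simp) fun i hi => by simp [hm i hi]⟩
  | tA hax h hv =>
    obtain ⟨L, hL, hm⟩ := hfam hv
    exact ⟨_ :: L, List.forall_mem_cons.2 ⟨h, hL⟩,
      .tA hax (by simp) fun i hi => by simp [hm i hi]⟩
  | seqA hax h1 h2 =>
    exact ⟨[_, _], by simpa using And.intro h1 h2, .seqA hax (List.mem_cons_self) (by simp)⟩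
  | teqA hax h1 h2 =>
    exact ⟨[_, _], by simpa using And.intro h1 h2, .teqA hax (List.mem_cons_self) (by simp)⟩
  | sSub hax hY hlen hJ hYc hargs =>
    obtain ⟨L, hL, hm⟩ := hfam fun i hi => hargs i hi (hlen ▸ hi)
    exact ⟨_ :: _ :: L, List.forall_mem_cons.2 ⟨hJ, List.forall_mem_cons.2 ⟨hYc, hL⟩⟩,
      .sSub hax hY hlen (List.mem_cons_self) (by simp) fun i hi _ => by simp [hm i hi]⟩
  | tSub hax hY hlen hJ hU hargs =>
    obtain ⟨L, hL, hm⟩ := hfam fun i hi => hargs i hi (hlen ▸ hi)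
    exact ⟨_ :: _ :: L, List.forall_mem_cons.2 ⟨hJ, List.forall_mem_cons.2 ⟨hU, hL⟩⟩,
      .tSub hax hY hlen (List.mem_cons_self) (by simp) fun i hi _ => by simp [hm i hi]⟩
  | seqSub1 hax hY hlen hJ h1 h2 hargs =>
    obtain ⟨L, hL, hm⟩ := hfam fun i hi => hargs i hi (hlen ▸ hi)
    exact ⟨_ :: _ :: _ :: L, List.forall_mem_cons.2 ⟨hJ, List.forall_mem_cons.2
        ⟨h1, List.forall_mem_cons.2 ⟨h2, hL⟩⟩⟩,
      .seqSub1 hax hY hlen (List.mem_cons_self) (by simp) (by simp)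
        fun i hi _ => by simp [hm i hi]⟩
  | seqSub2 hax hY hlf hlg hJ h1 h2 hargs =>
    obtain ⟨L, hL, hm⟩ := hfam fun i hi => hargs i hi (hlf ▸ hi) (hlg ▸ hi)
    exact ⟨_ :: _ :: _ :: L, List.forall_mem_cons.2 ⟨hJ, List.forall_mem_cons.2
        ⟨h1, List.forall_mem_cons.2 ⟨h2, hL⟩⟩⟩,
      .seqSub2 hax hY hlf hlg (List.mem_cons_self) (by simp) (by simp)
        fun i hi _ _ => by simp [hm i hi]⟩
  | teqSub1 hax hY hlen hJ h1 h2 hargs =>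
    obtain ⟨L, hL, hm⟩ := hfam fun i hi => hargs i hi (hlen ▸ hi)
    exact ⟨_ :: _ :: _ :: L, List.forall_mem_cons.2 ⟨hJ, List.forall_mem_cons.2
        ⟨h1, List.forall_mem_cons.2 ⟨h2, hL⟩⟩⟩,
      .teqSub1 hax hY hlen (List.mem_cons_self) (by simp) (by simp)
        fun i hi _ => by simp [hm i hi]⟩
  | teqSub2 hax hY hlf hlg hJ h1 h2 hargs =>
    obtain ⟨L, hL, hm⟩ := hfam fun i hi => hargs i hi (hlf ▸ hi) (hlg ▸ hi)
    exact ⟨_ :: _ :: _ :: L, List.forall_mem_cons.2 ⟨hJ, List.forall_mem_cons.2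
        ⟨h1, List.forall_mem_cons.2 ⟨h2, hL⟩⟩⟩,
      .teqSub2 hax hY hlf hlg (List.mem_cons_self) (by simp) (by simp)
        fun i hi _ _ => by simp [hm i hi]⟩

theorem Step.derivable {Ax : Set (Judg A)} {J : Judg A} (h : Step Ax (Derivable Ax) J) :
    Derivable Ax J := by
  obtain ⟨L, hL, hJ⟩ := h.finite
  obtain ⟨n, hn⟩ := exists_derAt_bound L hL
  exact ⟨n + 1, Or.inr (hJ.mono hn)⟩

/-! ## Presuppositions and heights -/

theorem DerAt.presup {Ax : Set (Judg A)} {n : ℕ} :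
    (∀ X U, DerAt Ax n (.sort X U) → ∃ m < n, DerAt Ax m (.ctx X)) ∧
    (∀ X u U, DerAt Ax n (.term X u U) → ∃ m < n, DerAt Ax m (.sort X U)) ∧
    (∀ X U V, DerAt Ax n (.sortEq X U V) →
      ∃ m < n, DerAt Ax m (.sort X U) ∧ DerAt Ax m (.sort X V)) := by
  induction n using Nat.strong_induction_on with
  | _ n ih =>
    refine ⟨fun X U h => ?_, fun X u U h => ?_, fun X U V h => ?_⟩
    all_goals
      obtain ⟨m, hm, hst⟩ := h.exists_step
      clear h
      obtain ⟨ihs, iht, ihe⟩ := ih m hm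
    · cases hst with
      | sA _ h _ => exact ⟨m, hm, h⟩
      | sSub _ _ _ _ h _ => exact ⟨m, hm, h⟩
    · cases hst with
      | seqt h1 h2 =>
        obtain ⟨k, hk, -, h⟩ := ihe _ _ _ h1
        exact ⟨k, hk.trans hm, h⟩
      | var hi h => exact ⟨m, hm, h⟩
      | tA _ h _ => exact ⟨m, hm, h⟩
      | tSub _ _ _ _ h _ => exact ⟨m, hm, h⟩
    · cases hst with
      | s1 h => exact ⟨m, hm, h, h⟩
      | s2 h =>
        obtain ⟨k, hk, h⟩ := ihe _ _ _ h
        exact ⟨k, hk.trans hm, h.symm⟩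
      | s3 h1 h2 =>
        obtain ⟨k, hk, h1, -⟩ := ihe _ _ _ h1
        obtain ⟨l, hl, -, h2⟩ := ihe _ _ _ h2
        exact ⟨max k l, (max_lt hk hl).trans hm, h1.mono (le_max_left _ _),
          h2.mono (le_max_right _ _)⟩
      | seqA _ h1 h2 => exact ⟨m, hm, h1, h2⟩
      | seqSub1 _ _ _ _ h1 h2 _ => exact ⟨m, hm, h1, h2⟩
      | seqSub2 _ _ _ _ _ h1 h2 _ => exact ⟨m, hm, h1, h2⟩

theorem DerAt.of_ctx_append {Ax : Set (Judg A)} {n : ℕ} {X : PreCtx A} {p : A.Var × SortE A}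
    (h : DerAt Ax n (.ctx (X ++ [p]))) : ∃ m < n, DerAt Ax m (.sort X p.2) := by
  obtain ⟨m, hm, hst⟩ := h.exists_step
  clear h
  generalize hZ : X ++ [p] = Z at hst
  cases hst with
  | ctx_nil => simp at hZ
  | ctx_cons h _ _ =>
    obtain ⟨rfl, hp⟩ := List.append_inj' hZ rfl
    obtain rfl := List.singleton_inj.1 hp
    exact ⟨m, hm, h⟩

theorem DerAt.sort_of_ctx {Ax : Set (Judg A)} {n : ℕ} {X : PreCtx A} (h : DerAt Ax n (.ctx X))
    {i : ℕ} (hi : i < X.length) : ∃ m < n, DerAt Ax m (.sort (X.take i) (X[i]).2) := by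
  induction X using List.reverseRecOn generalizing n with
  | nil => simp at hi
  | append_singleton X p ih =>
    obtain ⟨m, hm, h⟩ := h.of_ctx_append
    have hi' : i < X.length ∨ i = X.length := by
      simp at hi; omega
    rcases hi' with hi' | rfl
    · obtain ⟨k, hk, h⟩ := DerAt.presup.1 _ _ h
      obtain ⟨l, hl, h⟩ := ih h hi'
      refine ⟨l, by omega, ?_⟩
      simpa [List.getElem_append_left hi', List.take_append_of_le_length hi'.le] using h
    · exact ⟨m, hm, by simpa using h⟩

theorem Derivable.sort_of_ctx {Ax : Set (Judg A)} {X : PreCtx A} (h : Derivable Ax (.ctx X))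
    {i : ℕ} (hi : i < X.length) : Derivable Ax (.sort (X.take i) (X[i]).2) :=
  let ⟨_, h⟩ := h
  let ⟨m, _, h⟩ := h.sort_of_ctx hi
  ⟨m, h⟩

theorem Derivable.ctx_of_sort {Ax : Set (Judg A)} {X : PreCtx A} {U : SortE A}
    (h : Derivable Ax (.sort X U)) : Derivable Ax (.ctx X) :=
  let ⟨_, h⟩ := h
  let ⟨m, _, h⟩ := DerAt.presup.1 _ _ h
  ⟨m, h⟩

theorem Derivable.sort_of_term {Ax : Set (Judg A)} {X : PreCtx A} {u : Expr A} {U : SortE A}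
    (h : Derivable Ax (.term X u U)) : Derivable Ax (.sort X U) :=
  let ⟨_, h⟩ := h
  let ⟨m, _, h⟩ := DerAt.presup.2.1 _ _ _ h
  ⟨m, h⟩

theorem Derivable.ctx_append {Ax : Set (Judg A)} (hs : Shape Ax) {X : PreCtx A} {U : SortE A}
    {x : A.Var} (h : Derivable Ax (.sort X U)) (hx : ∀ p ∈ X, p.1 ≠ x) :
    Derivable Ax (.ctx (X ++ [(x, U)])) :=
  Step.derivable (.ctx_cons h hx ((h.goodJudg hs).1.append hx (h.goodJudg hs).2).isPreCtx)

theorem derAt_ht {Ax : Set (Judg A)} {J : Judg A} (h : Derivable Ax J) : DerAt Ax (ht Ax J) J :=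
  Nat.sInf_mem (s := {n | DerAt Ax n J}) h

theorem DerAt.ht_le {Ax : Set (Judg A)} {J : Judg A} {n : ℕ} (h : DerAt Ax n J) :
    ht Ax J ≤ n :=
  Nat.sInf_le h

theorem ht_sort_le_ht_term {Ax : Set (Judg A)} {X : PreCtx A} {u : Expr A} {U : SortE A}
    (h : Derivable Ax (.term X u U)) : ht Ax (.sort X U) ≤ ht Ax (.term X u U) := by
  obtain ⟨m, hm, h⟩ := DerAt.presup.2.1 _ _ _ (derAt_ht h)
  exact h.ht_le.trans hm.le

theorem htCtx_append {Ax : Set (Judg A)} {X : PreCtx A} {x : A.Var} {U : SortE A} :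
    htCtx Ax (X ++ [(x, U)]) = ht Ax (.sort X U) := by
  generalize hZ : X ++ [(x, U)] = Z
  cases Z with
  | nil => simp at hZ
  | cons p Z =>
    simp only [htCtx]
    simp only [← hZ, List.dropLast_concat, List.getLast_append_singleton]

theorem htCtx_eq {Ax : Set (Judg A)} {X : PreCtx A} {i : ℕ} (hi : X.length = i + 1) :
    htCtx Ax X = ht Ax (.sort (X.take i) (X[i]).2) := by
  induction X using List.reverseRecOn with
  | nil => simp at hi
  | append_singleton X p _ =>
    obtain rfl : X.length = i := by simpa using hi
    rw [htCtx_append]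
    simp

theorem ht_sort_le_htCtx {Ax : Set (Judg A)} {X : PreCtx A} (h : Derivable Ax (.ctx X)) {i : ℕ}
    (hi : i < X.length) : ht Ax (.sort (X.take i) (X[i]).2) ≤ htCtx Ax X := by
  induction X using List.reverseRecOn with
  | nil => simp at hi
  | append_singleton X p _ =>
    rw [htCtx_append]
    have hi' : i < X.length ∨ i = X.length := by
      simp at hi; omega
    rcases hi' with hi' | rfl
    · have hs := h.sort_of_ctx (i := X.length) (by simp)
      simp only [List.take_left, List.getElem_concat_length] at hs
      obtain ⟨k, hk, h⟩ := DerAt.presup.1 _ _ (derAt_ht hs)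
      obtain ⟨l, hl, h⟩ := h.sort_of_ctx hi'
      simp only [List.getElem_append_left hi', List.take_append_of_le_length hi'.le]
      exact h.ht_le.trans (by omega)
    · simp

theorem htCtx_le_ht_sort {Ax : Set (Judg A)} {X : PreCtx A} {U : SortE A}
    (h : Derivable Ax (.sort X U)) : htCtx Ax X ≤ ht Ax (.sort X U) := by
  obtain ⟨k, hk, h⟩ := DerAt.presup.1 _ _ (derAt_ht h)
  rcases hn : X.length with _ | i
  · simp [List.length_eq_zero_iff.1 hn, htCtx]
  · obtain ⟨l, hl, h⟩ := h.sort_of_ctx (i := i) (by omega)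
    rw [htCtx_eq hn]
    exact h.ht_le.trans (by omega)

/-! ## Admissibility of substitution -/

/-- The substitution `θ` sends the variables of `Y` to terms over `Z` of the right sorts. -/
def SubstOK (Ax : Set (Judg A)) (Z : PreCtx A) (θ : A.Var → Expr A) (Y : PreCtx A) : Prop :=
  ∀ i (hi : i < Y.length), Derivable Ax (.term Z (θ (Y[i]).1) ((Y[i]).2.subst θ))

/-- Derivability of the substitution instance over `Z` of a standard judgment. -/
def DerivableSubst (Ax : Set (Judg A)) (Z : PreCtx A) (θ : A.Var → Expr A) : Judg A → Prop
  | .ctx _ => True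
  | .sort _ U => Derivable Ax (.sort Z (U.subst θ))
  | .term _ u U => Derivable Ax (.term Z (u.subst θ) (U.subst θ))
  | .sortEq _ U V => Derivable Ax (.sortEq Z (U.subst θ) (V.subst θ))
  | .termEq _ u v U => Derivable Ax (.termEq Z (u.subst θ) (v.subst θ) (U.subst θ))

theorem SortE.substL_mkSub_map (θ : A.Var → Expr A) {Ax : Set (Judg A)} {X : PreCtx A}
    {U : SortE A} (hU : WFSort Ax (InCtx X) U) :
    U.substL (mkSub X (X.map fun p => θ p.1)) = U.subst θ :=
  SortE.subst_congr fun _ hx => lookupV_mkSub_map θ (hU.occurs hx)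

theorem Expr.substL_mkSub_map (θ : A.Var → Expr A) {Ax : Set (Judg A)} {X : PreCtx A}
    {u : Expr A} (hu : WFExpr Ax (InCtx X) u) :
    u.substL (mkSub X (X.map fun p => θ p.1)) = u.subst θ :=
  Expr.subst_congr fun _ hx => lookupV_mkSub_map θ (hu.occurs hx)

theorem SortE.substL_subst (θ : A.Var → Expr A) {Ax : Set (Judg A)} {X : PreCtx A}
    {U : SortE A} (hU : WFSort Ax (InCtx X) U) {f : List (Expr A)} (hf : X.length ≤ f.length) :
    (U.substL (mkSub X f)).subst θ = U.substL (mkSub X (f.map (Expr.subst θ))) :=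
  (SortE.subst_subst _ _ _).trans
    (SortE.subst_congr fun _ hx => lookupV_mkSub_subst θ (hU.occurs hx) hf)

theorem Expr.substL_subst (θ : A.Var → Expr A) {Ax : Set (Judg A)} {X : PreCtx A}
    {u : Expr A} (hu : WFExpr Ax (InCtx X) u) {f : List (Expr A)} (hf : X.length ≤ f.length) :
    (u.substL (mkSub X f)).subst θ = u.substL (mkSub X (f.map (Expr.subst θ))) :=
  (Expr.subst_subst _ _ _).trans
    (Expr.subst_congr fun _ hx => lookupV_mkSub_subst θ (hu.occurs hx) hf)

theorem subPre_map (θ : A.Var → Expr A) {Ax : Set (Judg A)} {X : PreCtx A}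
    (hX : GoodCtx Ax X) {i : ℕ} (hi : i < X.length) :
    subPre X (X.map fun p => θ p.1) i hi = (X[i]).2.subst θ := by
  unfold subPre
  rw [← List.map_take]
  exact SortE.substL_mkSub_map θ (hX.sorts i hi)

theorem subPre_subst (θ : A.Var → Expr A) {Ax : Set (Judg A)} {X : PreCtx A}
    (hX : GoodCtx Ax X) {f : List (Expr A)} (hf : X.length ≤ f.length) {i : ℕ}
    (hi : i < X.length) :
    (subPre X f i hi).subst θ = subPre X (f.map (Expr.subst θ)) i hi := by
  unfold subPre
  rw [← List.map_take]
  exact SortE.substL_subst θ (hX.sorts i hi) (by simp; omega)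

theorem ctxVars_subst (θ : A.Var → Expr A) (X : PreCtx A) :
    (ctxVars X).map (Expr.subst θ) = X.map fun p => θ p.1 := by
  simp [ctxVars, Expr.subst_var]

theorem DerAt.subst {Ax : Set (Judg A)} (hs : Shape Ax) {n : ℕ} {J : Judg A} (h : DerAt Ax n J)
    {Z : PreCtx A} (hZ : Derivable Ax (.ctx Z)) {θ : A.Var → Expr A}
    (hθ : SubstOK Ax Z θ J.ctxOf) : DerivableSubst Ax Z θ J := by
  induction n generalizing J with
  | zero => exact h.elim
  | succ n ih =>
    rcases h with h | h
    · exact ih h hθ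
    have hpre : IsPreCtx Z := GoodCtx.isPreCtx (hZ.goodJudg hs)
    have hJ : Derivable Ax J := ⟨n + 1, Or.inr h⟩
    have inst : ∀ {X : PreCtx A}, GoodCtx Ax X → SubstOK Ax Z θ X →
        ∀ i (hi : i < X.length) (hif : i < (X.map fun p => θ p.1).length),
        Derivable Ax (.term Z ((X.map fun p => θ p.1)[i]) (subPre X (X.map fun p => θ p.1) i hi)) := by
      intro X hX hθ i hi hif
      rw [subPre_map θ hX]
      simpa using hθ i hi
    cases h with
    | ctx_nil => trivial
    | ctx_cons _ _ _ => trivial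
    | s1 h => exact Step.derivable (.s1 (ih h hθ))
    | s2 h => exact Step.derivable (.s2 (ih h hθ))
    | s3 h1 h2 => exact Step.derivable (.s3 (ih h1 hθ) (ih h2 hθ))
    | t1 h => exact Step.derivable (.t1 (ih h hθ))
    | t2 h => exact Step.derivable (.t2 (ih h hθ))
    | t3 h1 h2 => exact Step.derivable (.t3 (ih h1 hθ) (ih h2 hθ))
    | seqt h1 h2 => exact Step.derivable (.seqt (ih h1 hθ) (ih h2 hθ))
    | seqteq h1 h2 h3 h4 =>
      exact Step.derivable (.seqteq (ih h1 hθ) (ih h2 hθ) (ih h3 hθ) (ih h4 hθ))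
    | var hi h =>
      simp only [DerivableSubst, Expr.subst_var]
      exact hθ _ hi
    | @sA X U hax h hv =>
      obtain ⟨S, ss⟩ := U
      obtain rfl : ss = ctxVars X := hs.sort _ _ hax
      have := Step.sSub hax hpre (f := X.map fun p => θ p.1) (by simp) hJ hZ
        (inst (h.goodJudg hs) hθ)
      simpa [DerivableSubst, SortE.subst, ctxVars_subst] using this.derivable
    | @tA X u U hax h hv =>
      obtain ⟨t, rfl⟩ := hs.term _ _ _ hax
      have hU := SortE.substL_mkSub_map θ (h.goodJudg hs).2
      have := Step.tSub hax hpre (f := X.map fun p => θ p.1) (by simp) hJ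
        (by rw [hU]; exact ih h hθ) (inst (h.goodJudg hs).1 hθ)
      simpa [DerivableSubst, Expr.subst_app, ctxVars_subst, hU] using this.derivable
    | @seqA X U U' hax h1 h2 =>
      have hU := SortE.substL_mkSub_map θ (h1.goodJudg hs).2
      have hU' := SortE.substL_mkSub_map θ (h2.goodJudg hs).2
      have := Step.seqSub1 hax hpre (f := X.map fun p => θ p.1) (by simp)
        (D := Derivable Ax) hJ
        (by rw [hU]; exact ih h1 hθ) (by rw [hU']; exact ih h2 hθ) (inst (h1.goodJudg hs).1 hθ)
      simpa only [DerivableSubst, hU, hU'] using this.derivable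
    | @teqA X u u' U hax h1 h2 =>
      have hU := SortE.substL_mkSub_map θ (h1.goodJudg hs).2.2
      have hu := Expr.substL_mkSub_map θ (h1.goodJudg hs).2.1
      have hu' := Expr.substL_mkSub_map θ (h2.goodJudg hs).2.1
      have := Step.teqSub1 hax hpre (f := X.map fun p => θ p.1) (by simp)
        (D := Derivable Ax) hJ
        (by rw [hU, hu]; exact ih h1 hθ) (by rw [hU, hu']; exact ih h2 hθ)
        (inst (h1.goodJudg hs).1 hθ)
      simpa only [DerivableSubst, hU, hu, hu'] using this.derivable
    | @sSub X S hax Y hY f hlen hJ' hYc hargs =>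
      refine Step.derivable (.sSub hax hpre (by simpa using hlen) ⟨n, hJ'⟩ hZ ?_)
      intro i hi hif
      rw [← subPre_subst θ (hJ'.goodJudg hs).1 hlen.ge]
      simpa [DerivableSubst] using ih (hargs i hi (hlen ▸ hi)) hθ
    | @tSub X t U hax Y hY f hlen hJ' hU hargs =>
      have hU' := SortE.substL_subst θ (hJ'.goodJudg hs).2.2 hlen.ge
      have := Step.tSub hax hpre (f := f.map (Expr.subst θ)) (by simpa using hlen)
        (D := Derivable Ax) ⟨n, hJ'⟩ (hU' ▸ ih hU hθ) (fun i hi hif => by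
          rw [← subPre_subst θ (hJ'.goodJudg hs).1 hlen.ge]
          simpa [DerivableSubst] using ih (hargs i hi (hlen ▸ hi)) hθ)
      simpa only [DerivableSubst, hU', Expr.subst_app] using this.derivable
    | @seqSub1 X U U' hax Y hY f hlen hJ' h1 h2 hargs =>
      have hU1 := SortE.substL_subst θ (hJ'.goodJudg hs).2.1 hlen.ge
      have hU2 := SortE.substL_subst θ (hJ'.goodJudg hs).2.2 hlen.ge
      have := Step.seqSub1 hax hpre (f := f.map (Expr.subst θ)) (by simpa using hlen)
        (D := Derivable Ax) ⟨n, hJ'⟩ (hU1 ▸ ih h1 hθ) (hU2 ▸ ih h2 hθ) (fun i hi hif => by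
          rw [← subPre_subst θ (hJ'.goodJudg hs).1 hlen.ge]
          simpa [DerivableSubst] using ih (hargs i hi (hlen ▸ hi)) hθ)
      simpa only [DerivableSubst, hU1, hU2] using this.derivable
    | @seqSub2 X S hax Y hY f g hlf hlg hJ' h1 h2 hargs =>
      refine Step.derivable (.seqSub2 hax hpre (by simpa using hlf) (by simpa using hlg)
        ⟨n, hJ'⟩ (ih h1 hθ) (ih h2 hθ) ?_)
      intro i hi hif hig
      rw [← subPre_subst θ (hJ'.goodJudg hs).1 hlf.ge]
      simpa [DerivableSubst] using ih (hargs i hi (hlf ▸ hi) (hlg ▸ hi)) hθ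
    | @teqSub1 X u u' U hax Y hY f hlen hJ' h1 h2 hargs =>
      have hu := Expr.substL_subst θ (hJ'.goodJudg hs).2.1 hlen.ge
      have hu' := Expr.substL_subst θ (hJ'.goodJudg hs).2.2.1 hlen.ge
      have hU := SortE.substL_subst θ (hJ'.goodJudg hs).2.2.2 hlen.ge
      have := Step.teqSub1 hax hpre (f := f.map (Expr.subst θ)) (by simpa using hlen)
        (D := Derivable Ax) ⟨n, hJ'⟩ (by rw [← hU, ← hu]; exact ih h1 hθ)
        (by rw [← hU, ← hu']; exact ih h2 hθ) (fun i hi hif => by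
          rw [← subPre_subst θ (hJ'.goodJudg hs).1 hlen.ge]
          simpa [DerivableSubst] using ih (hargs i hi (hlen ▸ hi)) hθ)
      simpa only [DerivableSubst, hU, hu, hu'] using this.derivable
    | @teqSub2 X t U hax Y hY f g hlf hlg hJ' h1 h2 hargs =>
      have hU := SortE.substL_subst θ (hJ'.goodJudg hs).2.2 hlf.ge
      have := Step.teqSub2 hax hpre (f := f.map (Expr.subst θ)) (g := g.map (Expr.subst θ))
        (by simpa using hlf) (by simpa using hlg) (D := Derivable Ax) ⟨n, hJ'⟩
        (by rw [← hU, ← Expr.subst_app]; exact ih h1 hθ)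
        (by rw [← hU, ← Expr.subst_app]; exact ih h2 hθ) (fun i hi hif hig => by
          rw [← subPre_subst θ (hJ'.goodJudg hs).1 hlf.ge]
          simpa [DerivableSubst] using ih (hargs i hi (hlf ▸ hi) (hlg ▸ hi)) hθ)
      simpa only [DerivableSubst, hU, Expr.subst_app] using this.derivable

theorem Derivable.subst {Ax : Set (Judg A)} (hs : Shape Ax) {J : Judg A} (h : Derivable Ax J)
    {Z : PreCtx A} (hZ : Derivable Ax (.ctx Z)) {θ : A.Var → Expr A}
    (hθ : SubstOK Ax Z θ J.ctxOf) : DerivableSubst Ax Z θ J :=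
  let ⟨_, h⟩ := h
  h.subst hs hZ hθ

/-- Every variable of a derivable context is a term of its declared sort. -/
theorem Derivable.ctx_var {Ax : Set (Judg A)} (hs : Shape Ax) {Z : PreCtx A}
    (hZ : Derivable Ax (.ctx Z)) {i : ℕ} (hi : i < Z.length) :
    Derivable Ax (.term Z (.var (Z[i]).1) (Z[i]).2) := by
  induction i using Nat.strong_induction_on with
  | _ i ih =>
    refine Step.derivable (.var hi ?_)
    have := (hZ.sort_of_ctx hi).subst hs hZ (θ := .var) fun k hk => by
      have hk' : k < i ∧ k < Z.length := by simpa [Judg.ctxOf] using hk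
      simpa [Judg.ctxOf, SortE.subst_id] using ih k hk'.1 hk'.2
    simpa [DerivableSubst, SortE.subst_id] using this

/-- Injective renaming of the variables of a derivable context. -/
theorem Derivable.ctx_rename {Ax : Set (Judg A)} (hs : Shape Ax) {π : A.Var → A.Var}
    (hπ : Function.Injective π) {Z : PreCtx A} (hZ : Derivable Ax (.ctx Z)) :
    Derivable Ax (.ctx (Z.map fun p => (π p.1, p.2.subst fun v => .var (π v)))) := by
  induction Z using List.reverseRecOn with
  | nil => exact Step.derivable .ctx_nil
  | append_singleton Z p ih =>
    have hp := hZ.sort_of_ctx (i := Z.length) (by simp)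
    simp only [List.take_left, List.getElem_concat_length] at hp
    have ih := ih hp.ctx_of_sort
    rw [List.map_append]
    refine Derivable.ctx_append hs (hp.subst hs ih fun k hk => ?_) fun q hq => ?_
    · have hk' : k < Z.length := hk
      have := ih.ctx_var hs (i := k) (by simpa using hk')
      simp only [List.getElem_map] at this
      exact this
    · obtain ⟨q', hq', rfl⟩ := List.mem_map.1 hq
      intro h
      have hn := (hZ.goodJudg hs).nodup
      rw [List.map_append, List.nodup_append] at hn
      exact hn.2.2 _ (List.mem_map.2 ⟨q', hq', rfl⟩) p.1 (by simp) (hπ h)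

theorem isMor_of_substOK {Ax : Set (Judg A)} (hs : Shape Ax) {X Y : PreCtx A}
    {f : List (Expr A)} (hX : Derivable Ax (.ctx X)) (hY : Derivable Ax (.ctx Y))
    {θ : A.Var → Expr A} (hθ : SubstOK Ax X θ Y) (hf : f = Y.map fun p => θ p.1) :
    IsMor Ax X Y f := by
  subst hf
  refine ⟨hX, hY, by simp, fun i hi hif => ?_⟩
  rw [subPre_map θ (hY.goodJudg hs)]
  simpa using hθ i hi

/-! ## Grids -/

theorem exists_index_of_lt_mul {m n k : ℕ} (h : k < m * n) :
    ∃ i < m, ∃ j < n, k = i * n + j := by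
  have hn : 0 < n := Nat.pos_of_mul_pos_left (Nat.zero_lt_of_lt h)
  refine ⟨k / n, (Nat.div_lt_iff_lt_mul hn).2 h, k % n, Nat.mod_lt _ hn, ?_⟩
  rw [mul_comm]
  exact (Nat.div_add_mod k n).symm

theorem index_lt_mul {m n i j : ℕ} (hi : i < m) (hj : j < n) : i * n + j < m * n := by
  nlinarith [Nat.mul_le_mul_right n (Nat.succ_le_of_lt hi)]

theorem exists_grid {γ : Type} {m n : ℕ} (P : ℕ → ℕ → γ → Prop)
    (h : ∀ i < m, ∀ j < n, ∃ w, P i j w) :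
    ∃ L : List γ, L.length = m * n ∧
      ∀ i j (_ : i < m) (_ : j < n) (hk : i * n + j < L.length), P i j L[i * n + j] := by
  have h' : ∀ k : Fin (m * n), ∃ w, P (k.1 / n) (k.1 % n) w := fun k => by
    have hn : 0 < n := Nat.pos_of_mul_pos_left (Nat.zero_lt_of_lt k.2)
    exact h _ ((Nat.div_lt_iff_lt_mul hn).2 k.2) _ (Nat.mod_lt _ hn)
  choose f hf using h'
  refine ⟨List.ofFn f, by simp, fun i j hi hj hk => ?_⟩
  have hn : 0 < n := Nat.zero_lt_of_lt hj
  have := hf ⟨i * n + j, index_lt_mul hi hj⟩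
  have h1 : (i * n + j) / n = i := by
    rw [mul_comm, Nat.mul_add_div hn, Nat.div_eq_of_lt hj, add_zero]
  have h2 : (i * n + j) % n = j := by
    rw [mul_comm, Nat.mul_add_mod, Nat.mod_eq_of_lt hj]
  simpa [h1, h2] using this

theorem IsGrid.mem {γ : Type} {m n : ℕ} {M : ℕ → ℕ → γ} {L : List γ} (h : IsGrid m n M L)
    {e : γ} (he : e ∈ L) : ∃ i < m, ∃ j < n, e = M i j := by
  obtain ⟨k, hk, rfl⟩ := List.getElem_of_mem he
  obtain ⟨i, hi, j, hj, rfl⟩ := exists_index_of_lt_mul (h.1 ▸ hk)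
  exact ⟨i, hi, j, hj, h.2 i j hi hj hk⟩

theorem IsGrid.ext {γ : Type} {m n : ℕ} {M M' : ℕ → ℕ → γ} {L L' : List γ}
    (h : IsGrid m n M L) (h' : IsGrid m n M' L') (hM : ∀ i < m, ∀ j < n, M i j = M' i j) :
    L = L' := by
  refine List.ext_getElem (h.1.trans h'.1.symm) fun k hk hk' => ?_
  obtain ⟨i, hi, j, hj, rfl⟩ := exists_index_of_lt_mul (h.1 ▸ hk)
  rw [h.2 i j hi hj hk, h'.2 i j hi hj hk', hM i hi j hj]

theorem IsGrid.map {γ δ : Type} {m n : ℕ} {M : ℕ → ℕ → γ} {L : List γ} (h : IsGrid m n M L)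
    (f : γ → δ) : IsGrid m n (fun i j => f (M i j)) (L.map f) :=
  ⟨by simpa using h.1, fun i j hi hj hk => by
    simpa using congrArg f (h.2 i j hi hj (by simpa using hk))⟩

theorem exists_index_of_lt_pred {m n k : ℕ} (h : k < (m + 1) * (n + 1) - 1) :
    ∃ i j, (i < m ∧ j < n ∨ i = m ∧ j < n ∨ i < m ∧ j = n) ∧ k = i * (n + 1) + j := by
  obtain ⟨i, hi, j, hj, rfl⟩ := exists_index_of_lt_mul (m := m + 1) (n := n + 1) (k := k) (by omega)
  refine ⟨i, j, ?_, rfl⟩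
  by_cases hc : i = m ∧ j = n
  · obtain ⟨rfl, rfl⟩ := hc
    have : (i + 1) * (j + 1) = i * (j + 1) + j + 1 := by ring
    omega
  · omega

theorem IsGrid.mem_dropLast {γ : Type} {m n : ℕ} {M : ℕ → ℕ → γ} {L : List γ}
    (h : IsGrid (m + 1) (n + 1) M L) {e : γ} (he : e ∈ L.dropLast) :
    ∃ i j, (i < m ∧ j < n ∨ i = m ∧ j < n ∨ i < m ∧ j = n) ∧ e = M i j := by
  obtain ⟨k, hk, rfl⟩ := List.getElem_of_mem he
  have hk' : k < (m + 1) * (n + 1) - 1 := by simpa [h.1] using hk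
  obtain ⟨i, j, hij, rfl⟩ := exists_index_of_lt_pred hk'
  refine ⟨i, j, hij, ?_⟩
  rw [List.getElem_dropLast]
  exact h.2 i j (by omega) (by omega) _

theorem IsGrid.dropLast_ext {γ : Type} {m n : ℕ} {M M' : ℕ → ℕ → γ} {L L' : List γ}
    (h : IsGrid (m + 1) (n + 1) M L) (h' : IsGrid (m + 1) (n + 1) M' L')
    (hM : ∀ i < m, ∀ j < n, M i j = M' i j) (hMx : ∀ j < n, M m j = M' m j)
    (hMy : ∀ i < m, M i n = M' i n) : L.dropLast = L'.dropLast := by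
  refine List.ext_getElem (by simp [h.1, h'.1]) fun k hk hk' => ?_
  have hk1 : k < (m + 1) * (n + 1) - 1 := by simpa [h.1] using hk
  obtain ⟨i, j, hij, rfl⟩ := exists_index_of_lt_pred hk1
  rw [List.getElem_dropLast, List.getElem_dropLast, h.2 i j (by omega) (by omega),
    h'.2 i j (by omega) (by omega)]
  rcases hij with ⟨hi, hj⟩ | ⟨rfl, hj⟩ | ⟨hi, rfl⟩
  · exact hM i hi j hj
  · exact hMx j hj
  · exact hMy i hi

/-! ## Canonical sorts -/

theorem CanonSort.var_inv {T : Set (Judg A)} {X : PreCtx A} {x : A.Var} {U : SortE A}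
    (h : CanonSort T X (.var x) U) : ∃ i, ∃ hi : i < X.length, (X[i]).1 = x ∧ (X[i]).2 = U := by
  generalize he : Expr.var x = e at h
  cases h with
  | var hi => exact ⟨_, hi, by simpa using he.symm, rfl⟩
  | app => simp at he

theorem CanonSort.app_inv {T : Set (Judg A)} {X : PreCtx A} {t : A.TermSym} {f : List (Expr A)}
    {U : SortE A} (h : CanonSort T X (.app t f) U) :
    ∃ Xa V, introTerm Xa t V ∈ T ∧ U = V.substL (mkSub Xa f) := by
  cases h with
  | app hax => exact ⟨_, _, hax, rfl⟩

theorem introTerm_unique {T : Set (Judg A)} (hT : IsPretheory T) {t : A.TermSym}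
    {X X' : PreCtx A} {U U' : SortE A} (h : introTerm X t U ∈ T) (h' : introTerm X' t U' ∈ T) :
    X = X' ∧ U = U' := by
  have := (hT.term_intro t).unique (y₁ := (X, U)) (y₂ := (X', U')) h h'
  simpa using this

theorem CanonSort.unique {T : Set (Judg A)} (hT : IsPretheory T) {X : PreCtx A}
    (hX : GoodCtx T X) {e : Expr A} {U U' : SortE A} (h : CanonSort T X e U)
    (h' : CanonSort T X e U') : U = U' := by
  cases e with
  | var x =>
    obtain ⟨i, hi, h1, rfl⟩ := h.var_inv
    obtain ⟨j, hj, h2, rfl⟩ := h'.var_inv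
    obtain rfl := hX.index_inj hi hj (h1.trans h2.symm)
    rfl
  | app t f =>
    obtain ⟨Xa, V, hax, rfl⟩ := h.app_inv
    obtain ⟨Xa', V', hax', rfl⟩ := h'.app_inv
    obtain ⟨rfl, rfl⟩ := introTerm_unique hT hax hax'
    rfl

theorem CanonSort.wfSort {T : Set (Judg A)} (hT : IsGAT T) {X : PreCtx A} (hX : GoodCtx T X)
    {e : Expr A} {U : SortE A} (he : WFExpr T (InCtx X) e) (h : CanonSort T X e U) :
    WFSort T (InCtx X) U := by
  cases he with
  | var hx =>
    obtain ⟨i, hi, -, rfl⟩ := h.var_inv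
    exact (hX.sorts i hi).mono fun _ => inCtx_of_take
  | app hax hlen hargs =>
    obtain ⟨Xa, V, hax', rfl⟩ := h.app_inv
    obtain ⟨rfl, rfl⟩ := introTerm_unique hT.1 hax hax'
    refine ((hT.2 _ hax).goodJudg hT.1.shape).2.2.subst fun x hx => ?_
    exact hargs _ (lookupV_mkSub_mem hx hlen.ge)

/-! ## Arguments of the tensor operations -/

/-- Well-formed arguments of the tensor term operation. -/
structure GArg (T : Set (Judg A)) (a : TArg A) : Prop where
  ctx : GoodCtx T a.ctx
  srt : WFSort T (InCtx a.ctx) a.srt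
  tm : (∃ x, a.tm = .var x) ∨ WFExpr T (InCtx a.ctx) a.tm

theorem GArg.withVar {T : Set (Judg A)} {X : PreCtx A} {u : Expr A} {U : SortE A}
    (h : GArg T ⟨X, u, U⟩) (x : A.Var) : GArg T ⟨X, .var x, U⟩ :=
  ⟨h.ctx, h.srt, .inl ⟨x, rfl⟩⟩

theorem GoodCtx.gArg {T : Set (Judg A)} {X : PreCtx A} (h : GoodCtx T X) {i : ℕ}
    (hi : i < X.length) (x : A.Var) : GArg T ⟨X.take i, .var x, (X[i]).2⟩ :=
  ⟨h.take i, h.sorts i hi, .inl ⟨x, rfl⟩⟩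

theorem GArg.wf_app {T : Set (Judg A)} {X : PreCtx A} {t : A.TermSym} {f : List (Expr A)}
    {U : SortE A} (h : GArg T ⟨X, .app t f, U⟩) : WFExpr T (InCtx X) (.app t f) := by
  rcases h.tm with ⟨x, hx⟩ | h
  · simp at hx
  · exact h

theorem GArg.wf_args {T : Set (Judg A)} {X : PreCtx A} {t : A.TermSym} {f : List (Expr A)}
    {U : SortE A} (h : GArg T ⟨X, .app t f, U⟩) : ∀ e ∈ f, WFExpr T (InCtx X) e := by
  cases h.wf_app with
  | app _ _ h => exact h

theorem gArg_canonSort {T : Set (Judg A)} (hT : IsGAT T) {X : PreCtx A} (hX : GoodCtx T X)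
    {f : List (Expr A)} (hf : ∀ e ∈ f, WFExpr T (InCtx X) e) {S : ℕ → SortE A}
    (hS : ∀ i (hi : i < f.length), CanonSort T X (f[i]'hi) (S i)) (i : ℕ) (hi : i < f.length) :
    GArg T ⟨X, f[i], S i⟩ :=
  ⟨hX, (hS i hi).wfSort hT hX (hf _ (List.getElem_mem hi)), .inr (hf _ (List.getElem_mem hi))⟩

theorem inCtx_of_wf_or {T : Set (Judg A)} {X : PreCtx A} {u : Expr A}
    (hu : WFExpr T (InCtx X) u) {v : A.Var} (h : InCtx X v ∨ Occurs v u) : InCtx X v :=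
  h.elim id hu.occurs

theorem inCtx_of_take_or {X : PreCtx A} {i : ℕ} (hi : i < X.length) {v : A.Var}
    (h : InCtx (X.take i) v ∨ Occurs v (.var (X[i]).1)) : InCtx X v := by
  rcases h with h | h
  · exact inCtx_of_take h
  · exact occurs_var_iff.1 h ▸ inCtx_getElem hi

/-! ## Lookup in the substitution lists of the tensor operations -/

theorem lookupV_pairsR_of_ne {x : A.Var} {Y : PreCtx B} {g : ℕ → Expr (A.tensor B)}
    {p : A.Var × B.Var} (h : p.1 ≠ x) :
    lookupV (A := A.tensor B) (pairsR x Y g) p = .var p := by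
  refine lookupV_eq_var fun q hq => ?_
  obtain ⟨j, -, rfl⟩ := List.mem_map.1 hq
  rintro rfl
  exact h rfl

theorem lookupV_pairsL_of_ne {X : PreCtx A} {y : B.Var} {g : ℕ → Expr (A.tensor B)}
    {p : A.Var × B.Var} (h : p.2 ≠ y) :
    lookupV (A := A.tensor B) (pairsL X y g) p = .var p := by
  refine lookupV_eq_var fun q hq => ?_
  obtain ⟨j, -, rfl⟩ := List.mem_map.1 hq
  rintro rfl
  exact h rfl

theorem lookupV_pairsR_getElem {x : A.Var} {Y : PreCtx B} {g : ℕ → Expr (A.tensor B)}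
    (hY : (Y.map Prod.fst).Nodup) {j : ℕ} (hj : j < Y.length) :
    lookupV (A := A.tensor B) (pairsR x Y g) (x, (Y[j]).1) = g j := by
  refine lookupV_eq_of_mem ?_ (List.mem_map.2 ⟨⟨j, hj⟩, List.mem_finRange _, rfl⟩)
  have : (pairsR x Y g).map Prod.fst = (Y.map Prod.fst).map fun v => (x, v) := by
    apply List.ext_getElem <;> simp [pairsR]
  rw [this]
  exact hY.map fun a b h => (Prod.mk.inj h).2

theorem lookupV_pairsL_getElem {X : PreCtx A} {y : B.Var} {g : ℕ → Expr (A.tensor B)}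
    (hX : (X.map Prod.fst).Nodup) {i : ℕ} (hi : i < X.length) :
    lookupV (A := A.tensor B) (pairsL X y g) ((X[i]).1, y) = g i := by
  refine lookupV_eq_of_mem ?_ (List.mem_map.2 ⟨⟨i, hi⟩, List.mem_finRange _, rfl⟩)
  have : (pairsL X y g).map Prod.fst = (X.map Prod.fst).map fun v => (v, y) := by
    apply List.ext_getElem <;> simp [pairsL]
  rw [this]
  exact hX.map fun a b h => (Prod.mk.inj h).1

/-! ## Variables occurring in tensors -/

theorem TTg.var_var {TA : Set (Judg A)} {TB : Set (Judg B)} {b : Bool} {X : PreCtx A}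
    {x : A.Var} {U : SortE A} {Y : PreCtx B} {y : B.Var} {V : SortE B} {e : Expr (A.tensor B)}
    (h : TTg TA TB b ⟨X, .var x, U⟩ ⟨Y, .var y, V⟩ e) : e = .var (x, y) := by
  cases h
  rfl

theorem TTg.occurs {TA : Set (Judg A)} {TB : Set (Judg B)} (hA : IsGAT TA) (hB : IsGAT TB)
    {a : TArg A} {c : TArg B} {e : Expr (A.tensor B)} (h : TTg TA TB false a c e)
    (ha : GArg TA a) (hc : GArg TB c) {p : A.Var × B.Var} (hp : Occurs (A := A.tensor B) p e) :
    (InCtx a.ctx p.1 ∨ Occurs p.1 a.tm) ∧ (InCtx c.ctx p.2 ∨ Occurs p.2 c.tm) := by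
  generalize hb : false = b at h
  induction h generalizing p with
  | varvar =>
    obtain rfl := occurs_var_iff.1 hp
    exact ⟨.inr .var, .inr .var⟩
  | @varapp b X x S ss Y t ts V SS TSf hSS hTS M out hM hMx hout ihM ihMx =>
    obtain ⟨e, he, hp⟩ := occurs_app_iff.1 hp
    obtain ⟨i, hi, j, hj, rfl⟩ := hout.mem he
    have hcj := gArg_canonSort hB hc.ctx hc.wf_args hTS j hj
    have hi' : i < ss.length ∨ i = ss.length := by omega
    rcases hi' with hi' | rfl
    · obtain ⟨h1, h2⟩ := ihM i hi' j hj (gArg_canonSort hA ha.ctx ha.srt hSS i hi') hcj hp hb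
      exact ⟨.inl (inCtx_of_wf_or (ha.srt _ (List.getElem_mem hi')) h1),
        .inl (inCtx_of_wf_or (hc.wf_args _ (List.getElem_mem hj)) h2)⟩
    · obtain ⟨h1, h2⟩ := ihMx j hj ha hcj hp hb
      exact ⟨h1, .inl (inCtx_of_wf_or (hc.wf_args _ (List.getElem_mem hj)) h2)⟩
  | @appvar b X s ss U Y y T ts SS TSf hSS hTS M out hM hMy hout ihM ihMy =>
    obtain ⟨e, he, hp⟩ := occurs_app_iff.1 hp
    obtain ⟨i, hi, j, hj, rfl⟩ := hout.mem he
    have hai := gArg_canonSort hA ha.ctx ha.wf_args hSS i hi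
    have hj' : j < ts.length ∨ j = ts.length := by omega
    rcases hj' with hj' | rfl
    · obtain ⟨h1, h2⟩ := ihM i hi j hj' hai (gArg_canonSort hB hc.ctx hc.srt hTS j hj') hp hb
      exact ⟨.inl (inCtx_of_wf_or (ha.wf_args _ (List.getElem_mem hi)) h1),
        .inl (inCtx_of_wf_or (hc.srt _ (List.getElem_mem hj')) h2)⟩
    · obtain ⟨h1, h2⟩ := ihMy i hi hai hc hp hb
      exact ⟨.inl (inCtx_of_wf_or (ha.wf_args _ (List.getElem_mem hi)) h1), h2⟩
  | @appapp_base X s ss U Y t ts V x hx e0 h0 g hg ih0 ihg =>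
    obtain ⟨q, hq, hp⟩ := occurs_subst hp
    obtain ⟨h1, h2⟩ := ih0 (ha.withVar x) hc hq rfl
    have hq2 : InCtx Y q.2 := inCtx_of_wf_or hc.wf_app h2
    by_cases hqx : q.1 = x
    · obtain ⟨j, hj, hj2⟩ := inCtx_iff.1 hq2
      have hl : lookupV (A := A.tensor B) (pairsR x Y g) q = g j := by
        rw [← lookupV_pairsR_getElem (x := x) (g := g) hc.ctx.nodup hj, hj2, ← hqx]
      rw [hl] at hp
      obtain ⟨h1, h2⟩ := ihg j hj ha (hc.ctx.gArg hj _) hp rfl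
      exact ⟨h1, .inl (inCtx_of_take_or hj h2)⟩
    · rw [lookupV_pairsR_of_ne hqx] at hp
      obtain rfl := occurs_var_iff.1 hp
      refine ⟨.inl (h1.resolve_right fun h => hqx (occurs_var_iff.1 h)), .inl hq2⟩
  | appapp_star => simp at hb

theorem TSo.occurs {TA : Set (Judg A)} {TB : Set (Judg B)} (hA : IsGAT TA) (hB : IsGAT TB)
    {X : PreCtx A} {x : A.Var} {U : SortE A} {Y : PreCtx B} {y : B.Var} {V : SortE B}
    {W : SortE (A.tensor B)} (h : TSo TA TB false X x U Y y V W) (hX : GoodCtx TA X)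
    (hU : WFSort TA (InCtx X) U) (hY : GoodCtx TB Y) (hV : WFSort TB (InCtx Y) V)
    {p : A.Var × B.Var} (hp : SOccurs (A := A.tensor B) p W) :
    InCtx X p.1 ∧ (InCtx Y p.2 ∨ p.2 = y) ∨ p.1 = x ∧ InCtx Y p.2 := by
  cases h with
  | mk hx hy SS TSf hSS hTS M out hM hMx hMy hout =>
    obtain ⟨e, he, hp⟩ := hp
    have hss := gArg_canonSort hA hX hU hSS
    have hts := gArg_canonSort hB hY hV hTS
    obtain ⟨i, j, hij, rfl⟩ := hout.mem_dropLast he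
    rcases hij with ⟨hi, hj⟩ | ⟨rfl, hj⟩ | ⟨hi, rfl⟩
    · obtain ⟨h1, h2⟩ := (hM i hi j hj).occurs hA hB (hss i hi) (hts j hj) hp
      exact .inl ⟨inCtx_of_wf_or (hU _ (List.getElem_mem hi)) h1,
        .inl (inCtx_of_wf_or (hV _ (List.getElem_mem hj)) h2)⟩
    · obtain ⟨h1, h2⟩ := (hMx j hj).occurs hA hB ⟨hX, hU, .inl ⟨x, rfl⟩⟩ (hts j hj) hp
      have h2 := inCtx_of_wf_or (hV _ (List.getElem_mem hj)) h2
      exact h1.elim (fun h1 => .inl ⟨h1, .inl h2⟩) fun h1 => .inr ⟨occurs_var_iff.1 h1, h2⟩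
    · obtain ⟨h1, h2⟩ := (hMy i hi).occurs hA hB (hss i hi) ⟨hY, hV, .inl ⟨y, rfl⟩⟩ hp
      exact .inl ⟨inCtx_of_wf_or (hU _ (List.getElem_mem hi)) h1, h2.imp_right occurs_var_iff.1⟩

/-! ## Renaming the variables of tensors -/

/-- The renaming of the variables of the tensor alphabet induced by renamings of the factors. -/
def renVar (σ : A.Var → A.Var) (τ : B.Var → B.Var) (p : A.Var × B.Var) : Expr (A.tensor B) :=
  .var (A := A.tensor B) (σ p.1, τ p.2)

theorem WFExpr.subst_ren {T : Set (Judg A)} {X : PreCtx A} {u : Expr A}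
    (hu : WFExpr T (InCtx X) u) {σ : A.Var → A.Var} (hσ : ∀ v, InCtx X v → σ v = v) :
    (u.subst fun v => .var (σ v)) = u :=
  Expr.subst_eq_self fun v hv => by rw [hσ v (hu.occurs hv)]

theorem TTg.rename {TA : Set (Judg A)} {TB : Set (Judg B)} (hA : IsGAT TA) (hB : IsGAT TB)
    {a : TArg A} {c : TArg B} {e : Expr (A.tensor B)} (h : TTg TA TB false a c e)
    (ha : GArg TA a) (hc : GArg TB c) {σ : A.Var → A.Var} {τ : B.Var → B.Var}
    (hσ : ∀ v, InCtx a.ctx v → σ v = v) (hτ : ∀ v, InCtx c.ctx v → τ v = v) :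
    TTg TA TB false ⟨a.ctx, a.tm.subst fun v => .var (σ v), a.srt⟩
      ⟨c.ctx, c.tm.subst fun v => .var (τ v), c.srt⟩ (e.subst (renVar σ τ)) := by
  have hfix : ∀ {a : TArg A} {c : TArg B} {e : Expr (A.tensor B)}, TTg TA TB false a c e →
      GArg TA a → GArg TB c → (∀ v, InCtx a.ctx v → σ v = v) → (∀ v, InCtx c.ctx v → τ v = v) →
      WFExpr TA (InCtx a.ctx) a.tm → WFExpr TB (InCtx c.ctx) c.tm →
      e.subst (renVar σ τ) = e := by
    intro a c e h ha hc hσ hτ hau hcv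
    refine Expr.subst_eq_self fun p hp => ?_
    obtain ⟨h1, h2⟩ := h.occurs hA hB ha hc hp
    simp [renVar, hσ _ (inCtx_of_wf_or hau h1), hτ _ (inCtx_of_wf_or hcv h2)]
  generalize hb : false = b at h
  induction h with
  | varvar =>
    subst hb
    simp only [Expr.subst_var, renVar]
    exact .varvar
  | @varapp b X x S ss Y t ts V SS TSf hSS hTS M out hM hMx hout ihM ihMx =>
    subst hb
    have hts := gArg_canonSort hB hc.ctx hc.wf_args hTS
    simp only [Expr.subst_var, hc.wf_app.subst_ren hτ]
    rw [Expr.subst_app]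
    refine .varapp SS TSf hSS hTS (fun i j => (M i j).subst (renVar σ τ)) _
      (fun i hi j hj => ?_) (fun j hj => ?_) (hout.map _)
    · have hu := ha.srt _ (List.getElem_mem hi)
      have hv := hc.wf_args _ (List.getElem_mem hj)
      have := hM i hi j hj
      rwa [hfix this (gArg_canonSort hA ha.ctx ha.srt hSS i hi) (hts j hj) hσ hτ hu hv]
    · have := ihMx j hj ha (hts j hj) hσ hτ rfl
      simpa only [Expr.subst_var, (hc.wf_args _ (List.getElem_mem hj)).subst_ren hτ] using this
  | @appvar b X s ss U Y y T ts SS TSf hSS hTS M out hM hMy hout ihM ihMy =>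
    subst hb
    have hss := gArg_canonSort hA ha.ctx ha.wf_args hSS
    simp only [Expr.subst_var, ha.wf_app.subst_ren hσ]
    rw [Expr.subst_app]
    refine .appvar SS TSf hSS hTS (fun i j => (M i j).subst (renVar σ τ)) _
      (fun i hi j hj => ?_) (fun i hi => ?_) (hout.map _)
    · have hu := ha.wf_args _ (List.getElem_mem hi)
      have hv := hc.srt _ (List.getElem_mem hj)
      have := hM i hi j hj
      rwa [hfix this (hss i hi) (gArg_canonSort hB hc.ctx hc.srt hTS j hj) hσ hτ hu hv]
    · have := ihMy i hi (hss i hi) hc hσ hτ rfl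
      simpa only [Expr.subst_var, (ha.wf_args _ (List.getElem_mem hi)).subst_ren hσ] using this
  | @appapp_base X s ss U Y t ts V x hx e0 h0 g hg ih0 ihg =>
    have := TTg.appapp_base hx e0 h0 g hg
    simpa only [ha.wf_app.subst_ren hσ, hc.wf_app.subst_ren hτ,
      hfix this ha hc hσ hτ ha.wf_app hc.wf_app] using this
  | appapp_star => simp at hb

theorem TSo.rename {TA : Set (Judg A)} {TB : Set (Judg B)} (hA : IsGAT TA) (hB : IsGAT TB)
    {X : PreCtx A} {x : A.Var} {U : SortE A} {Y : PreCtx B} {y : B.Var} {V : SortE B}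
    {W : SortE (A.tensor B)} (h : TSo TA TB false X x U Y y V W) (hX : GoodCtx TA X)
    (hU : WFSort TA (InCtx X) U) (hY : GoodCtx TB Y) (hV : WFSort TB (InCtx Y) V)
    {σ : A.Var → A.Var} {τ : B.Var → B.Var}
    (hσ : ∀ v, InCtx X v → σ v = v) (hτ : ∀ v, InCtx Y v → τ v = v)
    (hσx : ∀ p ∈ X, p.1 ≠ σ x) (hτy : ∀ p ∈ Y, p.1 ≠ τ y) :
    TSo TA TB false X (σ x) U Y (τ y) V (W.subst (renVar σ τ)) := by
  cases h with
  | mk hx hy SS TSf hSS hTS M out hM hMx hMy hout =>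
    have hss := gArg_canonSort hA hX hU hSS
    have hts := gArg_canonSort hB hY hV hTS
    have hu := fun i hi => (hU _ (List.getElem_mem (n := i) hi)).subst_ren hσ
    have hv := fun j hj => (hV _ (List.getElem_mem (n := j) hj)).subst_ren hτ
    simp only [SortE.subst, List.map_dropLast]
    refine .mk hσx hτy SS TSf hSS hTS (fun i j => (M i j).subst (renVar σ τ)) _
      (fun i hi j hj => ?_) (fun j hj => ?_) (fun i hi => ?_) (hout.map _)
    · simpa only [hu i hi, hv j hj] using (hM i hi j hj).rename hA hB (hss i hi) (hts j hj) hσ hτ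
    · simpa only [Expr.subst_var, hv j hj] using
        (hMx j hj).rename hA hB ⟨hX, hU, .inl ⟨x, rfl⟩⟩ (hts j hj) hσ hτ
    · simpa only [Expr.subst_var, hu i hi] using
        (hMy i hi).rename hA hB (hss i hi) ⟨hY, hV, .inl ⟨y, rfl⟩⟩ hσ hτ

/-! ## Tensors are uniquely determined -/

open Classical in
theorem TTg.unique {TA : Set (Judg A)} {TB : Set (Judg B)} (hA : IsGAT TA) (hB : IsGAT TB)
    {a : TArg A} {c : TArg B} {e e' : Expr (A.tensor B)} (h : TTg TA TB false a c e)
    (h' : TTg TA TB false a c e') (ha : GArg TA a) (hc : GArg TB c) : e = e' := by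
  generalize hb : false = b at h
  induction h generalizing e' with
  | varvar => exact h'.var_var.symm
  | @varapp b X x S ss Y t ts V SS TSf hSS hTS M out hM hMx hout ihM ihMx =>
    cases h' with
    | varapp SS' TSf' hSS' hTS' M' out' hM' hMx' hout' =>
      have hss := gArg_canonSort hA ha.ctx ha.srt hSS
      have hts := gArg_canonSort hB hc.ctx hc.wf_args hTS
      rw [hout.ext hout' fun i hi j hj => ?_]
      have hi' : i < ss.length ∨ i = ss.length := by omega
      have ht := (hTS j hj).unique hB.1 hc.ctx (hTS' j hj)
      rcases hi' with hi' | rfl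
      · have hs := (hSS i hi').unique hA.1 ha.ctx (hSS' i hi')
        exact ihM i hi' j hj (hs ▸ ht ▸ hM' i hi' j hj) (hss i hi') (hts j hj) hb
      · exact ihMx j hj (ht ▸ hMx' j hj) ha (hts j hj) hb
  | @appvar b X s ss U Y y T ts SS TSf hSS hTS M out hM hMy hout ihM ihMy =>
    cases h' with
    | appvar SS' TSf' hSS' hTS' M' out' hM' hMy' hout' =>
      have hss := gArg_canonSort hA ha.ctx ha.wf_args hSS
      have hts := gArg_canonSort hB hc.ctx hc.srt hTS
      rw [hout.ext hout' fun i hi j hj => ?_]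
      have hj' : j < ts.length ∨ j = ts.length := by omega
      have hs := (hSS i hi).unique hA.1 ha.ctx (hSS' i hi)
      rcases hj' with hj' | rfl
      · have ht := (hTS j hj').unique hB.1 hc.ctx (hTS' j hj')
        exact ihM i hi j hj' (hs ▸ ht ▸ hM' i hi j hj') (hss i hi) (hts j hj') hb
      · exact ihMy i hi (hs ▸ hMy' i hi) (hss i hi) hc hb
  | @appapp_base X s ss U Y t ts V x hx e0 h0 g hg ih0 ihg =>
    cases h' with
    | @appapp_base _ _ _ _ _ _ _ _ x' hx' e0' h0' g' hg' =>
      have hσ : ∀ v, InCtx X v → Function.update id x' x v = v := by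
        intro v hv
        obtain ⟨p, hp, rfl⟩ := List.mem_map.1 hv
        simp [Function.update_of_ne (hx' p hp)]
      have hr := h0'.rename hA hB (ha.withVar x') hc hσ (τ := id) fun _ _ => rfl
      simp only [Expr.subst_var, Function.update_self, id, Expr.subst_id] at hr
      rw [ih0 hr (ha.withVar x) hc rfl]
      refine (Expr.subst_subst _ _ _).trans (Expr.subst_congr fun p hp => ?_)
      obtain ⟨h1, h2⟩ := h0'.occurs hA hB (ha.withVar x') hc hp
      have hp2 : InCtx Y p.2 := inCtx_of_wf_or hc.wf_app h2
      simp only [renVar, Expr.subst_var]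
      rcases h1 with h1 | h1
      · have h1' := hσ _ h1
        obtain ⟨q, hq, hqp⟩ := List.mem_map.1 h1
        simp only [h1']
        rw [lookupV_pairsR_of_ne (hqp ▸ hx q hq), lookupV_pairsR_of_ne (hqp ▸ hx' q hq)]
        rfl
      · obtain ⟨p1, p2⟩ := p
        obtain rfl : p1 = x' := occurs_var_iff.1 h1
        obtain ⟨j, hj, rfl⟩ := inCtx_iff.1 hp2
        simp only [Function.update_self, id]
        rw [lookupV_pairsR_getElem hc.ctx.nodup hj, lookupV_pairsR_getElem hc.ctx.nodup hj]
        exact ihg j hj (hg' j hj) ha (hc.ctx.gArg hj _) rfl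
  | appapp_star => simp at hb

theorem TSo.unique {TA : Set (Judg A)} {TB : Set (Judg B)} (hA : IsGAT TA) (hB : IsGAT TB)
    {X : PreCtx A} {x : A.Var} {U : SortE A} {Y : PreCtx B} {y : B.Var} {V : SortE B}
    {W W' : SortE (A.tensor B)} (h : TSo TA TB false X x U Y y V W)
    (h' : TSo TA TB false X x U Y y V W') (hX : GoodCtx TA X)
    (hU : WFSort TA (InCtx X) U) (hY : GoodCtx TB Y) (hV : WFSort TB (InCtx Y) V) : W = W' := by
  cases h with
  | mk hx hy SS TSf hSS hTS M out hM hMx hMy hout =>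
    cases h' with
    | mk hx' hy' SS' TSf' hSS' hTS' M' out' hM' hMx' hMy' hout' =>
      have hss := gArg_canonSort hA hX hU hSS
      have hts := gArg_canonSort hB hY hV hTS
      have hS := fun i hi => (hSS i hi).unique hA.1 hX (hSS' i hi)
      have hT := fun j hj => (hTS j hj).unique hB.1 hY (hTS' j hj)
      rw [hout.dropLast_ext hout' (fun i hi j hj => ?_) (fun j hj => ?_) (fun i hi => ?_)]
      · exact (hM i hi j hj).unique hA hB (hS i hi ▸ hT j hj ▸ hM' i hi j hj) (hss i hi) (hts j hj)
      · exact (hMx j hj).unique hA hB (hT j hj ▸ hMx' j hj) ⟨hX, hU, .inl ⟨x, rfl⟩⟩ (hts j hj)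
      · exact (hMy i hi).unique hA hB (hS i hi ▸ hMy' i hi) (hss i hi) ⟨hY, hV, .inl ⟨y, rfl⟩⟩

/-! ## Tensor precontexts -/

theorem TCtx.entry {TA : Set (Judg A)} {TB : Set (Judg B)} {b : Bool} {X : PreCtx A}
    {Y : PreCtx B} {Z : PreCtx (A.tensor B)} (h : TCtx TA TB b X Y Z) {i j : ℕ}
    (hi : i < X.length) (hj : j < Y.length) :
    ∃ hk : i * Y.length + j < Z.length,
      (Z[i * Y.length + j]).1 = ((X[i]).1, (Y[j]).1) ∧
      TSo TA TB b (X.take i) (X[i]).1 (X[i]).2 (Y.take j) (Y[j]).1 (Y[j]).2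
        (Z[i * Y.length + j]).2 :=
  have hk := h.1 ▸ index_lt_mul hi hj
  ⟨hk, h.2 i j hi hj hk⟩

theorem TCtx.exists_take {TA : Set (Judg A)} {TB : Set (Judg B)} {b : Bool} {X : PreCtx A}
    {Y : PreCtx B} {Z : PreCtx (A.tensor B)} (h : TCtx TA TB b X Y Z) (m n : ℕ) :
    ∃ Z', TCtx TA TB b (X.take m) (Y.take n) Z' ∧ ∀ q ∈ Z', q ∈ Z := by
  obtain ⟨Z', hl, hZ'⟩ := exists_grid (m := (X.take m).length) (n := (Y.take n).length)
    (P := fun i j q => ∃ (hi : i < X.length) (hj : j < Y.length)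
      (hk : i * Y.length + j < Z.length), q = Z[i * Y.length + j]) fun i hi j hj => by
    have hi' : i < m ∧ i < X.length := by simpa using hi
    have hj' : j < n ∧ j < Y.length := by simpa using hj
    exact ⟨_, hi'.2, hj'.2, (h.entry hi'.2 hj'.2).1, rfl⟩
  refine ⟨Z', ⟨hl, fun i j hi hj hk => ?_⟩, fun q hq => ?_⟩
  · obtain ⟨hi', hj', hk', hq⟩ := hZ' i j hi hj hk
    have him : i < m ∧ i < X.length := by simpa using hi
    have hjn : j < n ∧ j < Y.length := by simpa using hj
    rw [hq]
    have := h.2 i j hi' hj' hk'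
    simpa [List.take_take, him.1.le, hjn.1.le] using this
  · obtain ⟨k, hk, rfl⟩ := List.getElem_of_mem hq
    obtain ⟨i, hi, j, hj, rfl⟩ := exists_index_of_lt_mul (hl ▸ hk)
    obtain ⟨_, _, hk', hq⟩ := hZ' i j hi hj hk
    exact hq ▸ List.getElem_mem hk'

/-- The precontext `X'` arises from `X` by renaming along `σ` variables that do not occur in
the sorts of `X`. -/
structure RenCtx (σ : A.Var → A.Var) (X X' : PreCtx A) : Prop where
  length : X'.length = X.length
  entry : ∀ i (hi : i < X.length) (hi' : i < X'.length), X'[i] = (σ (X[i]).1, (X[i]).2)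
  take : ∀ i < X.length, X'.take i = X.take i
  fix : ∀ i < X.length, ∀ v, InCtx (X.take i) v → σ v = v
  fresh : ∀ i (hi : i < X.length), ∀ p ∈ X.take i, p.1 ≠ σ (X[i]).1

theorem GoodCtx.ne_of_mem_take {T : Set (Judg A)} {X : PreCtx A} (h : GoodCtx T X) {i : ℕ}
    (hi : i < X.length) : ∀ p ∈ X.take i, p.1 ≠ (X[i]).1 := fun p hp he =>
  h.not_inCtx_take hi (List.mem_map.2 ⟨p, hp, he⟩)

theorem GoodCtx.renCtx_id {T : Set (Judg A)} {X : PreCtx A} (h : GoodCtx T X) :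
    RenCtx id X X :=
  ⟨rfl, fun _ _ _ => rfl, fun _ _ => rfl, fun _ _ _ _ => rfl, fun _ => h.ne_of_mem_take⟩

theorem GoodCtx.renCtx_append {T : Set (Judg A)} {X : PreCtx A} {x : A.Var} {U : SortE A}
    (h : GoodCtx T (X ++ [(x, U)])) {σ : A.Var → A.Var} (hσ : ∀ v, InCtx X v → σ v = v)
    (hx : ∀ p ∈ X, p.1 ≠ σ x) : RenCtx σ (X ++ [(x, U)]) (X ++ [(σ x, U)]) where
  length := by simp
  entry i hi hi' := by
    rcases lt_or_eq_of_le (Nat.le_of_lt_succ (by simpa using hi : i < X.length + 1)) with h | rfl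
    · simp [List.getElem_append_left h, hσ _ (inCtx_getElem h)]
    · simp
  take i hi := by
    have hi' : i ≤ X.length := Nat.le_of_lt_succ (by simpa using hi)
    rw [List.take_append_of_le_length hi', List.take_append_of_le_length hi']
  fix i hi v hv := by
    have hi' : i ≤ X.length := Nat.le_of_lt_succ (by simpa using hi)
    rw [List.take_append_of_le_length hi'] at hv
    exact hσ v (inCtx_of_take hv)
  fresh i hi p hp := by
    rcases lt_or_eq_of_le (Nat.le_of_lt_succ (by simpa using hi : i < X.length + 1)) with h' | rfl
    · have := h.ne_of_mem_take hi p hp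
      simpa [List.getElem_append_left h', hσ _ (inCtx_getElem h')] using this
    · simpa using hx p (by simpa using hp)

/-- Renaming the variables of a precontext over the tensor alphabet. -/
def renPre (σ : A.Var → A.Var) (τ : B.Var → B.Var) (Z : PreCtx (A.tensor B)) :
    PreCtx (A.tensor B) :=
  Z.map fun p => ((σ p.1.1, τ p.1.2), p.2.subst (renVar σ τ))

theorem TCtx.rename {TA : Set (Judg A)} {TB : Set (Judg B)} (hA : IsGAT TA) (hB : IsGAT TB)
    {X X' : PreCtx A} {Y Y' : PreCtx B} {Z : PreCtx (A.tensor B)} (hX : GoodCtx TA X)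
    (hY : GoodCtx TB Y) (h : TCtx TA TB false X Y Z) {σ : A.Var → A.Var} {τ : B.Var → B.Var}
    (hσ : RenCtx σ X X') (hτ : RenCtx τ Y Y') : TCtx TA TB false X' Y' (renPre σ τ Z) := by
  refine ⟨by simp [renPre, h.1, hσ.length, hτ.length], fun i j hi hj hk => ?_⟩
  have hi' := hσ.length ▸ hi
  have hj' := hτ.length ▸ hj
  obtain ⟨hk', h1, h2⟩ := h.entry hi' hj'
  simp only [hσ.entry i hi' hi, hτ.entry j hj' hj, hσ.take i hi', hτ.take j hj', renPre,
    List.getElem_map, hτ.length, h1, true_and]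
  exact h2.rename hA hB (hX.take i) (hX.sorts i hi') (hY.take j) (hY.sorts j hj')
    (hσ.fix i hi') (hτ.fix j hj') (hσ.fresh i hi') (hτ.fresh j hj')

theorem renVar_comp {σ : A.Var → A.Var} {τ : B.Var → B.Var} (hσ : ∀ v, σ (σ v) = v)
    (hτ : ∀ v, τ (τ v) = v) (p : A.Var × B.Var) :
    (renVar σ τ p).subst (renVar σ τ) = .var (A := A.tensor B) p := by
  simp [renVar, Expr.subst_var, hσ, hτ]

theorem renPre_renPre {σ : A.Var → A.Var} {τ : B.Var → B.Var} (hσ : ∀ v, σ (σ v) = v)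
    (hτ : ∀ v, τ (τ v) = v) (Z : PreCtx (A.tensor B)) : renPre σ τ (renPre σ τ Z) = Z := by
  unfold renPre
  rw [List.map_map]
  refine (List.map_congr_left fun p _ => ?_).trans (List.map_id Z)
  simp only [Function.comp, SortE.subst_subst, renVar_comp hσ hτ, SortE.subst_id, hσ, hτ, id]

theorem Derivable.ctx_var_of_mem {Ax : Set (Judg A)} (hs : Shape Ax) {Z : PreCtx A}
    (hZ : Derivable Ax (.ctx Z)) {q : A.Var × SortE A} (hq : q ∈ Z) :
    Derivable Ax (.term Z (.var q.1) q.2) := by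
  obtain ⟨i, hi, rfl⟩ := List.getElem_of_mem hq
  exact hZ.ctx_var hs hi

theorem substOK_renPre {Ax : Set (Judg (A.tensor B))} (hs : Shape Ax)
    {Z Z' : PreCtx (A.tensor B)} (hZ : Derivable Ax (.ctx Z)) (hsub : ∀ q ∈ Z', q ∈ Z)
    {σ : A.Var → A.Var} {τ : B.Var → B.Var} (hσ : ∀ v, σ (σ v) = v) (hτ : ∀ v, τ (τ v) = v) :
    SubstOK Ax Z (renVar σ τ) (renPre σ τ Z') := by
  intro k hk
  have hk' : k < Z'.length := by simpa [renPre] using hk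
  have := hZ.ctx_var_of_mem hs (hsub _ (List.getElem_mem hk'))
  have hv : renVar σ τ (σ (Z'[k]).1.1, τ (Z'[k]).1.2) = .var (A := A.tensor B) (Z'[k]).1 := by
    simp only [renVar, hσ, hτ]
  simpa only [renPre, List.getElem_map, SortE.subst_subst, renVar_comp hσ hτ, SortE.subst_id,
    hv] using this

/-! ## The axioms of the tensor product -/

theorem ctxVars_getElem {X : PreCtx A} {i : ℕ} (hi : i < (ctxVars X).length) :
    (ctxVars X)[i] = .var (X[i]'(by simpa [ctxVars] using hi)).1 := by
  simp [ctxVars]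

theorem ctxVars_length (X : PreCtx A) : (ctxVars X).length = X.length := by
  simp [ctxVars]

/-- The variables of a tensor precontext form a grid. -/
theorem TCtx.isGrid {TA : Set (Judg A)} {TB : Set (Judg B)} {b : Bool} {X : PreCtx A}
    {Y : PreCtx B} {Z : PreCtx (A.tensor B)} (h : TCtx TA TB b X Y Z)
    {M : ℕ → ℕ → Expr (A.tensor B)}
    (hM : ∀ i (hi : i < X.length) j (hj : j < Y.length),
      M i j = .var (A := A.tensor B) ((X[i]).1, (Y[j]).1)) :
    IsGrid X.length Y.length M (ctxVars Z) :=
  ⟨by simpa [ctxVars] using h.1, fun i j hi hj hk => by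
    rw [ctxVars_getElem, hM i hi j hj, (h.entry hi hj).2.1]⟩

theorem tensorAx_shape {TA : Set (Judg A)} {TB : Set (Judg B)} (hA : IsPretheory TA)
    (hB : IsPretheory TB) {chA : PreCtx A → A.Var} {chB : PreCtx B → B.Var} :
    Shape (tensorAx TA TB chA chB) where
  sort := by
    rintro Z W ⟨J, J', hJ, hJ', h⟩
    cases h with
    | @ss X U Y V Z W hZ hW =>
      have hU := hA.sort_shape _ _ hJ
      have hV := hB.sort_shape _ _ hJ'
      cases hW with
      | mk hx hy SS TSf hSS hTS M out hM hMx hMy hout =>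
        dsimp only at hU hV ⊢
        subst hU hV
        have hg := hZ.isGrid (M := fun i j => if i = X.length ∧ j = Y.length then
          .var (chA X, chB Y) else M i j) fun i hi j hj => by
            have hi' : i < X.length ∨ i = X.length := by simp at hi; omega
            have hj' : j < Y.length ∨ j = Y.length := by simp at hj; omega
            rcases hi' with hi' | rfl <;> rcases hj' with hj' | rfl
            · have := hM i (by simpa [ctxVars] using hi') j (by simpa [ctxVars] using hj')
              simp only [ctxVars_getElem] at this
              simpa [hi'.ne, List.getElem_append_left hi', List.getElem_append_left hj']
                using this.var_var
            · have := hMy i (by simpa [ctxVars] using hi')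
              simp only [ctxVars_getElem, ctxVars_length] at this
              simpa [hi'.ne, List.getElem_append_left hi'] using this.var_var
            · have := hMx j (by simpa [ctxVars] using hj')
              simp only [ctxVars_getElem, ctxVars_length] at this
              simpa [hj'.ne, List.getElem_append_left hj'] using this.var_var
            · simp
        simp only [List.length_append, List.length_singleton] at hg
        simp only [ctxVars_length] at hout
        rw [hout.dropLast_ext hg (fun i hi j hj => by simp [hi.ne])
          (fun j hj => by simp [hj.ne]) fun i hi => by simp [hi.ne]]
        simp [ctxVars]
  term := by
    rintro Z e W ⟨J, J', hJ, hJ', h⟩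
    cases h with
    | @st X U Y v V Z e W g hZ he hW hg =>
      have hU := hA.sort_shape _ _ hJ
      obtain ⟨t, rfl⟩ := hB.term_shape _ _ _ hJ'
      cases he with
      | @varapp _ _ _ S ss _ _ ts _ SS TSf hSS hTS M out hM hMx hout =>
        dsimp only at hU
        subst hU
        refine ⟨Sum.inl (S, t), congrArg _ ?_⟩
        have hg := hZ.isGrid (M := M) fun i hi j hj => by
            have hi' : i < X.length ∨ i = X.length := by simp at hi; omega
            rcases hi' with hi' | rfl
            · have := hM i (by simpa [ctxVars] using hi') j (by simpa [ctxVars] using hj)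
              simp only [ctxVars_getElem] at this
              simpa [List.getElem_append_left hi'] using this.var_var
            · have := hMx j (by simpa [ctxVars] using hj)
              simp only [ctxVars_getElem, ctxVars_length] at this
              simpa using this.var_var
        simp only [List.length_append, List.length_singleton] at hg
        simp only [ctxVars_length] at hout
        exact hout.ext hg fun _ _ _ _ => rfl
    | @ts X u U Y V Z e W g hZ he hW hg =>
      have hV := hB.sort_shape _ _ hJ'
      obtain ⟨t, rfl⟩ := hA.term_shape _ _ _ hJ
      cases he with
      | @appvar _ _ _ ss _ _ _ T ts SS TSf hSS hTS M out hM hMy hout =>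
        dsimp only at hV
        subst hV
        refine ⟨Sum.inr (t, T), congrArg _ ?_⟩
        have hg := hZ.isGrid (M := M) fun i hi j hj => by
            have hj' : j < Y.length ∨ j = Y.length := by simp at hj; omega
            rcases hj' with hj' | rfl
            · have := hM i (by simpa [ctxVars] using hi) j (by simpa [ctxVars] using hj')
              simp only [ctxVars_getElem] at this
              simpa [List.getElem_append_left hj'] using this.var_var
            · have := hMy i (by simpa [ctxVars] using hi)
              simp only [ctxVars_getElem, ctxVars_length] at this
              simpa using this.var_var
        simp only [List.length_append, List.length_singleton] at hg
        simp only [ctxVars_length] at hout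
        exact hout.ext hg fun _ _ _ _ => rfl

/-! ## Derivability in the tensor product -/

theorem exists_swap {α : Type*} (x c : α) :
    ∃ σ : α → α, σ x = c ∧ (∀ v, σ (σ v) = v) ∧ ∀ v, v ≠ x → v ≠ c → σ v = v := by
  classical
  exact ⟨Equiv.swap x c, Equiv.swap_apply_left x c, Equiv.congr_fun (Equiv.swap_swap x c),
    fun v => Equiv.swap_apply_of_ne_of_ne⟩

theorem ne_of_inCtx {X : PreCtx A} {x v : A.Var} (hx : ∀ p ∈ X, p.1 ≠ x) (hv : InCtx X v) :
    v ≠ x := by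
  obtain ⟨p, hp, rfl⟩ := List.mem_map.1 hv
  exact hx p hp

theorem TCtx.nodup {TA : Set (Judg A)} {TB : Set (Judg B)} {X : PreCtx A}
    {Y : PreCtx B} {Z : PreCtx (A.tensor B)} (hX : GoodCtx TA X) (hY : GoodCtx TB Y)
    (h : TCtx TA TB false X Y Z) : (Z.map Prod.fst).Nodup := by
  refine List.nodup_iff_injective_get.2 fun ⟨k, hk⟩ ⟨k', hk'⟩ he => ?_
  have hk1 : k < Z.length := by simpa using hk
  have hk2 : k' < Z.length := by simpa using hk'
  obtain ⟨i, hi, j, hj, rfl⟩ := exists_index_of_lt_mul (h.1 ▸ hk1)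
  obtain ⟨i', hi', j', hj', rfl⟩ := exists_index_of_lt_mul (h.1 ▸ hk2)
  have he' : (Z[i * Y.length + j]).1 = (Z[i' * Y.length + j']).1 := by simpa using he
  rw [(h.entry hi hj).2.1, (h.entry hi' hj').2.1, Prod.mk.injEq] at he'
  obtain rfl := hX.index_inj hi hi' he'.1
  obtain rfl := hY.index_inj hj hj' he'.2
  rfl

theorem TCtx.ctx_of_swap {Ax : Set (Judg (A.tensor B))} (hs : Shape Ax)
    {σ : A.Var → A.Var} {τ : B.Var → B.Var} (hσ : ∀ v, σ (σ v) = v) (hτ : ∀ v, τ (τ v) = v)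
    {Z : PreCtx (A.tensor B)} (h : Derivable Ax (.ctx (renPre σ τ Z))) :
    Derivable Ax (.ctx Z) := by
  have hπ : Function.Injective fun p : A.Var × B.Var => (σ p.1, τ p.2) := fun p q hpq => by
    have h1 := congrArg σ (congrArg Prod.fst hpq)
    have h2 := congrArg τ (congrArg Prod.snd hpq)
    simp only [hσ, hτ] at h1 h2
    exact Prod.ext h1 h2
  have h' : Derivable Ax (.ctx (renPre σ τ (renPre σ τ Z))) :=
    Derivable.ctx_rename hs (A := A.tensor B) hπ h
  rwa [renPre_renPre hσ hτ] at h'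

section

variable {TA : Set (Judg A)} {TB : Set (Judg B)} {chA : PreCtx A → A.Var}
  {chB : PreCtx B → B.Var} {h : ℕ}

theorem hDerivable.ctx_tensor (hder : hDerivable TA TB chA chB h) (hA : IsGAT TA)
    (hB : IsGAT TB) (hchA : FreshCh chA) (hchB : FreshCh chB) {X : PreCtx A} {Y : PreCtx B}
    (hX : Derivable TA (.ctx X)) (hY : Derivable TB (.ctx Y))
    (hh : htCtx TA X * htCtx TB Y ≤ h) {Z : PreCtx (A.tensor B)}
    (hZ : TCtx TA TB false X Y Z) : Derivable (tensorAx TA TB chA chB) (.ctx Z) := by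
  have hs := tensorAx_shape hA.1 hB.1 (chA := chA) (chB := chB)
  have hnil : Z = [] → Derivable (tensorAx TA TB chA chB) (.ctx Z) := by
    rintro rfl
    exact Step.derivable .ctx_nil
  rcases List.eq_nil_or_concat' X with rfl | ⟨X0, ⟨x, U⟩, rfl⟩
  · exact hnil (List.length_eq_zero_iff.1 (by simpa using hZ.1))
  rcases List.eq_nil_or_concat' Y with rfl | ⟨Y0, ⟨y, V⟩, rfl⟩
  · exact hnil (List.length_eq_zero_iff.1 (by simpa using hZ.1))
  have gX : GoodCtx TA (X0 ++ [(x, U)]) := hX.goodJudg hA.1.shape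
  have gY : GoodCtx TB (Y0 ++ [(y, V)]) := hY.goodJudg hB.1.shape
  have hU : Derivable TA (.sort X0 U) := by
    simpa using hX.sort_of_ctx (i := X0.length) (by simp)
  have hV : Derivable TB (.sort Y0 V) := by
    simpa using hY.sort_of_ctx (i := Y0.length) (by simp)
  have hx : ∀ p ∈ X0, p.1 ≠ x := by
    simpa using gX.ne_of_mem_take (i := X0.length) (by simp)
  have hy : ∀ p ∈ Y0, p.1 ≠ y := by
    simpa using gY.ne_of_mem_take (i := Y0.length) (by simp)
  obtain ⟨σ, hσx, hσσ, hσ⟩ := exists_swap x (chA X0)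
  obtain ⟨τ, hτy, hττ, hτ⟩ := exists_swap y (chB Y0)
  have rX := gX.renCtx_append (σ := σ)
    (fun v hv => hσ v (ne_of_inCtx hx hv) (ne_of_inCtx (hchA X0) hv)) (hσx ▸ hchA X0)
  have rY := gY.renCtx_append (σ := τ)
    (fun v hv => hτ v (ne_of_inCtx hy hv) (ne_of_inCtx (hchB Y0) hv)) (hτy ▸ hchB Y0)
  rw [hσx] at rX
  rw [hτy] at rY
  refine TCtx.ctx_of_swap hs hσσ hττ ?_
  have hZ' := hZ.rename hA hB gX gY rX rY
  generalize renPre σ τ Z = Z' at hZ'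
  have gX' : GoodCtx TA (X0 ++ [(chA X0, U)]) :=
    (hU.ctx_append hA.1.shape (hchA X0)).goodJudg hA.1.shape
  have gY' : GoodCtx TB (Y0 ++ [(chB Y0, V)]) :=
    (hV.ctx_append hB.1.shape (hchB Y0)).goodJudg hB.1.shape
  have hn := hZ'.nodup gX' gY'
  have hl : Z'.length = (X0.length + 1) * (Y0.length + 1) := by simpa using hZ'.1
  obtain ⟨hk, h1, h2⟩ := hZ'.entry (i := X0.length) (j := Y0.length) (by simp) (by simp)
  rcases List.eq_nil_or_concat' Z' with rfl | ⟨Z0, ⟨z, W⟩, rfl⟩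
  · simp at hl
  have hidx : X0.length * (Y0 ++ [(chB Y0, V)]).length + Y0.length = Z0.length := by
    have : Z0.length + 1 = (X0.length + 1) * (Y0.length + 1) := by simpa using hl
    simp only [List.length_append, List.length_singleton]
    linarith
  simp only [hidx, List.getElem_concat_length, List.take_left'] at h1 h2
  have hss := hder _ _ _ hU hV (by rwa [htCtx_append, htCtx_append] at hh)
    (.ss hZ' (by simpa using h2))
  rw [List.dropLast_concat] at hss
  refine hss.ctx_append hs fun p hp hpz => ?_
  simp only [List.map_append, List.map_cons, List.map_nil, List.nodup_append] at hn
  exact hn.2.2 p.1 (List.mem_map_of_mem hp) z (by simp) hpz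

theorem hDerivable.term_sort (hder : hDerivable TA TB chA chB h) (hA : IsGAT TA)
    (hB : IsGAT TB) (hchA : FreshCh chA) (hchB : FreshCh chB) {X : PreCtx A} {u : Expr A}
    {U : SortE A} {x : A.Var} {Y : PreCtx B} {y : B.Var} {V : SortE B}
    (hu : Derivable TA (.term X u U)) (hx : ∀ p ∈ X, p.1 ≠ x)
    (hV : Derivable TB (.sort Y V)) (hy : ∀ p ∈ Y, p.1 ≠ y)
    (hh : ht TA (.term X u U) * ht TB (.sort Y V) ≤ h) {Z Z' : PreCtx (A.tensor B)}
    (hZ : Derivable (tensorAx TA TB chA chB) (.ctx Z))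
    (hZ' : TCtx TA TB false X (Y ++ [(y, V)]) Z') (hsub : ∀ q ∈ Z', q ∈ Z)
    {e : Expr (A.tensor B)} (he : TTg TA TB false ⟨X, u, U⟩ ⟨Y, .var y, V⟩ e)
    {W : SortE (A.tensor B)} (hW : TSo TA TB false X x U Y y V W) {g : ℕ → Expr (A.tensor B)}
    (hg : ∀ j (hj : j < Y.length),
      TTg TA TB false ⟨X, u, U⟩ ⟨Y.take j, .var (Y[j]).1, (Y[j]).2⟩ (g j)) :
    Derivable (tensorAx TA TB chA chB) (.term Z e (W.substL (pairsR x Y g))) := by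
  have hs := tensorAx_shape hA.1 hB.1 (chA := chA) (chB := chB)
  obtain ⟨gX, wu, wU⟩ := hu.goodJudg hA.1.shape
  obtain ⟨gY, wV⟩ := hV.goodJudg hB.1.shape
  have gY' : GoodCtx TB (Y ++ [(y, V)]) := gY.append hy wV
  have gu : GArg TA ⟨X, u, U⟩ := ⟨gX, wU, .inr wu⟩
  obtain ⟨σ, hσx, hσσ, hσ⟩ := exists_swap x (chA X)
  obtain ⟨τ, hτy, hττ, hτ⟩ := exists_swap y (chB Y)
  have hσX : ∀ v, InCtx X v → σ v = v := fun v hv =>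
    hσ v (ne_of_inCtx hx hv) (ne_of_inCtx (hchA X) hv)
  have hτY : ∀ v, InCtx Y v → τ v = v := fun v hv =>
    hτ v (ne_of_inCtx hy hv) (ne_of_inCtx (hchB Y) hv)
  have rY := gY'.renCtx_append hτY (hτy ▸ hchB Y)
  rw [hτy] at rY
  have hZr := hZ'.rename hA hB gX gY' gX.renCtx_id rY
  have her := he.rename hA hB gu ⟨gY, wV, .inl ⟨y, rfl⟩⟩ (σ := id) (fun _ _ => rfl) hτY
  have hWr := hW.rename hA hB gX wU gY wV hσX hτY (hσx ▸ hchA X) (hτy ▸ hchB Y)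
  have hid : (u.subst fun v => .var (id v)) = u := u.subst_id
  simp only [hid, Expr.subst_var, hτy] at her
  rw [hσx, hτy] at hWr
  have key := (hder _ _ _ hu hV hh (.ts hZr her hWr hg)).subst hs hZ
    (substOK_renPre hs hZ hsub (fun _ => rfl) hττ)
  simp only [DerivableSubst, Expr.subst_subst, renVar_comp (σ := id) (fun _ => rfl) hττ,
    Expr.subst_id, SortE.substL, SortE.subst_subst] at key
  convert key using 2
  refine SortE.subst_congr fun p hp => ?_
  rcases hW.occurs hA hB gX wU gY wV hp with ⟨hp1, -⟩ | ⟨hp1, hp2⟩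
  · simp only [renVar, Expr.subst_var, hσX _ hp1]
    rw [lookupV_pairsR_of_ne (ne_of_inCtx hx hp1),
      lookupV_pairsR_of_ne (p := (p.1, τ p.2)) (ne_of_inCtx (hchA X) hp1)]
    exact (renVar_comp (σ := id) (fun _ => rfl) hττ p).symm
  · obtain ⟨p1, p2⟩ := p
    dsimp only at hp1 hp2
    subst hp1
    obtain ⟨l, hl, rfl⟩ := inCtx_iff.1 hp2
    simp only [renVar, Expr.subst_var, hτY _ hp2, hσx]
    rw [lookupV_pairsR_getElem gY.nodup hl, lookupV_pairsR_getElem gY.nodup hl]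
    refine (Expr.subst_eq_self fun q hq => ?_).symm
    have hq' := ((hg l hl).occurs hA hB gu (gY.gArg hl _) hq).2
    simp [renVar, hτY _ (inCtx_of_take_or hl hq')]

theorem hDerivable.sort_term (hder : hDerivable TA TB chA chB h) (hA : IsGAT TA)
    (hB : IsGAT TB) (hchA : FreshCh chA) (hchB : FreshCh chB) {X : PreCtx A} {x : A.Var}
    {U : SortE A} {Y : PreCtx B} {v : Expr B} {V : SortE B} {y : B.Var}
    (hU : Derivable TA (.sort X U)) (hx : ∀ p ∈ X, p.1 ≠ x)
    (hv : Derivable TB (.term Y v V)) (hy : ∀ p ∈ Y, p.1 ≠ y)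
    (hh : ht TA (.sort X U) * ht TB (.term Y v V) ≤ h) {Z Z' : PreCtx (A.tensor B)}
    (hZ : Derivable (tensorAx TA TB chA chB) (.ctx Z))
    (hZ' : TCtx TA TB false (X ++ [(x, U)]) Y Z') (hsub : ∀ q ∈ Z', q ∈ Z)
    {e : Expr (A.tensor B)} (he : TTg TA TB false ⟨X, .var x, U⟩ ⟨Y, v, V⟩ e)
    {W : SortE (A.tensor B)} (hW : TSo TA TB false X x U Y y V W) {g : ℕ → Expr (A.tensor B)}
    (hg : ∀ i (hi : i < X.length),
      TTg TA TB false ⟨X.take i, .var (X[i]).1, (X[i]).2⟩ ⟨Y, v, V⟩ (g i)) :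
    Derivable (tensorAx TA TB chA chB) (.term Z e (W.substL (pairsL X y g))) := by
  have hs := tensorAx_shape hA.1 hB.1 (chA := chA) (chB := chB)
  obtain ⟨gX, wU⟩ := hU.goodJudg hA.1.shape
  obtain ⟨gY, wv, wV⟩ := hv.goodJudg hB.1.shape
  have gX' : GoodCtx TA (X ++ [(x, U)]) := gX.append hx wU
  have gv : GArg TB ⟨Y, v, V⟩ := ⟨gY, wV, .inr wv⟩
  obtain ⟨σ, hσx, hσσ, hσ⟩ := exists_swap x (chA X)
  obtain ⟨τ, hτy, hττ, hτ⟩ := exists_swap y (chB Y)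
  have hσX : ∀ v, InCtx X v → σ v = v := fun v hv =>
    hσ v (ne_of_inCtx hx hv) (ne_of_inCtx (hchA X) hv)
  have hτY : ∀ v, InCtx Y v → τ v = v := fun v hv =>
    hτ v (ne_of_inCtx hy hv) (ne_of_inCtx (hchB Y) hv)
  have rX := gX'.renCtx_append hσX (hσx ▸ hchA X)
  rw [hσx] at rX
  have hZr := hZ'.rename hA hB gX' gY rX gY.renCtx_id
  have her := he.rename hA hB ⟨gX, wU, .inl ⟨x, rfl⟩⟩ gv (τ := id) hσX (fun _ _ => rfl)
  have hWr := hW.rename hA hB gX wU gY wV hσX hτY (hσx ▸ hchA X) (hτy ▸ hchB Y)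
  have hid : (v.subst fun v => .var (id v)) = v := v.subst_id
  simp only [hid, Expr.subst_var, hσx] at her
  rw [hσx, hτy] at hWr
  have key := (hder _ _ _ hU hv hh (.st hZr her hWr hg)).subst hs hZ
    (substOK_renPre hs hZ hsub hσσ (fun _ => rfl))
  simp only [DerivableSubst, Expr.subst_subst, renVar_comp (τ := id) hσσ (fun _ => rfl),
    Expr.subst_id, SortE.substL, SortE.subst_subst] at key
  convert key using 2
  refine SortE.subst_congr fun p hp => ?_
  obtain ⟨p1, p2⟩ := p
  have hcase : InCtx Y p2 ∨ (InCtx X p1 ∧ p2 = y) := by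
    rcases hW.occurs hA hB gX wU gY wV hp with ⟨hp1, hp2 | hp2⟩ | ⟨-, hp2⟩
    exacts [.inl hp2, .inr ⟨hp1, hp2⟩, .inl hp2]
  rcases hcase with hp2 | ⟨hp1, rfl⟩
  · simp only [renVar, Expr.subst_var, hτY _ hp2]
    rw [lookupV_pairsL_of_ne (ne_of_inCtx hy hp2),
      lookupV_pairsL_of_ne (p := (σ p1, p2)) (ne_of_inCtx (hchB Y) hp2)]
    exact (renVar_comp (τ := id) hσσ (fun _ => rfl) (p1, p2)).symm
  · obtain ⟨l, hl, rfl⟩ := inCtx_iff.1 hp1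
    simp only [renVar, Expr.subst_var, hσX _ hp1, hτy]
    rw [lookupV_pairsL_getElem gX.nodup hl, lookupV_pairsL_getElem gX.nodup hl]
    refine (Expr.subst_eq_self fun q hq => ?_).symm
    have hq' := ((hg l hl).occurs hA hB (gX.gArg hl _) gv hq).1
    simp [renVar, hσX _ (inCtx_of_take_or hl hq')]

end

section

variable {TA : Set (Judg A)} {TB : Set (Judg B)} {chA : PreCtx A → A.Var}
  {chB : PreCtx B → B.Var} {h : ℕ}

theorem hDerivable.isMor_secL (hder : hDerivable TA TB chA chB h) (hA : IsGAT TA)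
    (hB : IsGAT TB) (hchA : FreshCh chA) (hchB : FreshCh chB) {X : PreCtx A} {Y : PreCtx B}
    (hY : Derivable TB (.ctx Y)) {u : Expr A} {U : SortE A} {x : A.Var}
    {out : List (Expr (A.tensor B))} {Z Z' : PreCtx (A.tensor B)}
    (hu : Derivable TA (.term X u U)) (hh : ht TA (.term X u U) * htCtx TB Y ≤ h)
    (hx : ∀ p ∈ X, p.1 ≠ x) (hout : TSecL TA TB false X u U Y out)
    (hZ : TCtx TA TB false X Y Z) (hZ' : TCtx TA TB false (X ++ [(x, U)]) Y Z') :
    IsMor (tensorAx TA TB chA chB) Z Z' out := by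
  have hs := tensorAx_shape hA.1 hB.1 (chA := chA) (chB := chB)
  have hU := hu.sort_of_term
  have hX := hU.ctx_of_sort
  have gX : GoodCtx TA X := hX.goodJudg hA.1.shape
  have gY : GoodCtx TB Y := hY.goodJudg hB.1.shape
  have wU : WFSort TA (InCtx X) U := (hU.goodJudg hA.1.shape).2
  have hX' := hU.ctx_append hA.1.shape hx
  have hhU : ht TA (.sort X U) * htCtx TB Y ≤ h :=
    (Nat.mul_le_mul_right _ (ht_sort_le_ht_term hu)).trans hh
  have dZ := hder.ctx_tensor hA hB hchA hchB hX hY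
    ((Nat.mul_le_mul_right _ (htCtx_le_ht_sort hU)).trans hhU) hZ
  have dZ' := hder.ctx_tensor hA hB hchA hchB hX' hY (htCtx_append.symm ▸ hhU) hZ'
  obtain ⟨hol, ho1, ho2⟩ := hout
  have hl : Z'.length = out.length := by simpa [hol] using hZ'.1
  have hn : (Z'.map Prod.fst).Nodup := GoodCtx.nodup (dZ'.goodJudg hs)
  set θ := lookupV (mkSub Z' out)
  have hθ : ∀ k (hk : k < Z'.length), θ (Z'[k]).1 = out[k] := fun k hk =>
    lookupV_mkSub_getElem hn hl hk
  have hθX : ∀ p : A.Var × B.Var, InCtx X p.1 → InCtx Y p.2 → θ p = .var p := by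
    rintro ⟨p1, p2⟩ hp1 hp2
    obtain ⟨i, hi, rfl⟩ := inCtx_iff.1 hp1
    obtain ⟨j, hj, rfl⟩ := inCtx_iff.1 hp2
    obtain ⟨hk, h1, -⟩ := hZ'.entry (i := i) (j := j) (by simp; omega) hj
    rw [List.getElem_append_left hi] at h1
    rw [← h1, hθ _ hk, h1]
    exact (ho1 i j hi hj _).var_var
  have hθx : ∀ j (hj : j < Y.length) (hk : X.length * Y.length + j < out.length),
      θ (x, (Y[j]).1) = out[X.length * Y.length + j] := fun j hj hk => by
    obtain ⟨hk, h1, -⟩ := hZ'.entry (i := X.length) (j := j) (by simp) hj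
    simp only [List.getElem_concat_length] at h1
    rw [← h1, hθ _ hk]
  have hko : ∀ j < Y.length, X.length * Y.length + j < out.length := fun j hj => by
    rw [hol]; exact index_lt_mul X.length.lt_succ_self hj
  refine isMor_of_substOK hs dZ dZ' (θ := θ) (fun k hk => ?_)
    (List.ext_getElem (by simp [hl]) fun k hk hk' => by
      rw [List.getElem_map, hθ k (by simpa using hk')])
  obtain ⟨i, hi, j, hj, rfl⟩ := exists_index_of_lt_mul (hZ'.1 ▸ hk)
  obtain ⟨hk, h1, h2⟩ := hZ'.entry hi hj
  rw [h1]
  have hi' : i < X.length ∨ i = X.length := by simp at hi; omega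
  rcases hi' with hi' | rfl
  · simp only [List.getElem_append_left hi', List.take_append_of_le_length hi'.le] at h2 ⊢
    obtain ⟨hkZ, h1Z, h2Z⟩ := hZ.entry hi' hj
    have hW := h2.unique hA hB h2Z (gX.take i) (gX.sorts i hi') (gY.take j) (gY.sorts j hj)
    rw [hθX _ (inCtx_getElem hi') (inCtx_getElem hj), hW, SortE.subst_eq_self, ← h1Z]
    · exact dZ.ctx_var hs hkZ
    · intro p hp
      rcases h2Z.occurs hA hB (gX.take i) (gX.sorts i hi') (gY.take j) (gY.sorts j hj) hp with
        ⟨hp1, hp2⟩ | ⟨hp1, hp2⟩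
      · refine hθX p (inCtx_of_take hp1) ?_
        rcases hp2 with hp2 | hp2
        exacts [inCtx_of_take hp2, hp2 ▸ inCtx_getElem hj]
      · exact hθX p (hp1 ▸ inCtx_getElem hi') (inCtx_of_take hp2)
  · simp only [List.getElem_concat_length, List.take_left'] at h2 ⊢
    obtain ⟨Z0, hZ0, hsub⟩ := hZ.exists_take X.length (j + 1)
    rw [List.take_length, List.take_succ_eq_append_getElem hj] at hZ0
    have key := hder.term_sort hA hB hchA hchB hu hx (hY.sort_of_ctx hj)
      (gY.ne_of_mem_take hj) ((Nat.mul_le_mul_left _ (ht_sort_le_htCtx hY hj)).trans hh) dZ hZ0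
      hsub (ho2 j hj (hko j hj)) h2
      (g := fun l => out.getD (X.length * Y.length + l) (.var (x, (Y[j]).1)))
      fun l hl => by
        have hl' : l < j ∧ l < Y.length := by simpa using hl
        have := ho2 l hl'.2 (hko l hl'.2)
        simpa [List.take_take, hl'.1.le, hko l hl'.2] using this
    rw [hθx j hj (hko j hj)]
    convert key using 2
    refine SortE.subst_congr fun p hp => ?_
    rcases h2.occurs hA hB gX wU (gY.take j) (gY.sorts j hj) hp with ⟨hp1, hp2⟩ | ⟨hp1, hp2⟩
    · rw [lookupV_pairsR_of_ne (ne_of_inCtx hx hp1)]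
      refine hθX p hp1 ?_
      rcases hp2 with hp2 | hp2
      exacts [inCtx_of_take hp2, hp2 ▸ inCtx_getElem hj]
    · obtain ⟨p1, p2⟩ := p
      dsimp only at hp1 hp2
      subst hp1
      obtain ⟨l, hl, rfl⟩ := inCtx_iff.1 hp2
      have hl' : l < j ∧ l < Y.length := by simpa using hl
      rw [lookupV_pairsR_getElem (gY.take j).nodup hl]
      simp only [List.getElem_take]
      rw [hθx l hl'.2 (hko l hl'.2)]
      simp [hko l hl'.2]

theorem hDerivable.isMor_secR (hder : hDerivable TA TB chA chB h) (hA : IsGAT TA)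
    (hB : IsGAT TB) (hchA : FreshCh chA) (hchB : FreshCh chB) {X : PreCtx A} {Y : PreCtx B}
    (hX : Derivable TA (.ctx X)) {v : Expr B} {V : SortE B} {y : B.Var}
    {out : List (Expr (A.tensor B))} {Z Z' : PreCtx (A.tensor B)}
    (hv : Derivable TB (.term Y v V)) (hh : htCtx TA X * ht TB (.term Y v V) ≤ h)
    (hy : ∀ p ∈ Y, p.1 ≠ y) (hout : TSecR TA TB false X Y v V out)
    (hZ : TCtx TA TB false X Y Z) (hZ' : TCtx TA TB false X (Y ++ [(y, V)]) Z') :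
    IsMor (tensorAx TA TB chA chB) Z Z' out := by
  have hs := tensorAx_shape hA.1 hB.1 (chA := chA) (chB := chB)
  have hV := hv.sort_of_term
  have hY := hV.ctx_of_sort
  have gX : GoodCtx TA X := hX.goodJudg hA.1.shape
  have gY : GoodCtx TB Y := hY.goodJudg hB.1.shape
  have wV : WFSort TB (InCtx Y) V := (hV.goodJudg hB.1.shape).2
  have hY' := hV.ctx_append hB.1.shape hy
  have hhV : htCtx TA X * ht TB (.sort Y V) ≤ h :=
    (Nat.mul_le_mul_left _ (ht_sort_le_ht_term hv)).trans hh
  have dZ := hder.ctx_tensor hA hB hchA hchB hX hY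
    ((Nat.mul_le_mul_left _ (htCtx_le_ht_sort hV)).trans hhV) hZ
  have dZ' := hder.ctx_tensor hA hB hchA hchB hX hY' (htCtx_append.symm ▸ hhV) hZ'
  obtain ⟨hol, ho1, ho2⟩ := hout
  have hlY : (Y ++ [(y, V)]).length = Y.length + 1 := by simp
  have hl : Z'.length = out.length := by simpa [hol] using hZ'.1
  have hn : (Z'.map Prod.fst).Nodup := GoodCtx.nodup (dZ'.goodJudg hs)
  set θ := lookupV (mkSub Z' out)
  have hθ : ∀ k (hk : k < Z'.length), θ (Z'[k]).1 = out[k] := fun k hk =>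
    lookupV_mkSub_getElem hn hl hk
  have hent : ∀ i (hi : i < X.length) j (hj : j < (Y ++ [(y, V)]).length),
      ∃ hk : i * (Y.length + 1) + j < Z'.length,
        (Z'[i * (Y.length + 1) + j]).1 = ((X[i]).1, ((Y ++ [(y, V)])[j]).1) ∧
        TSo TA TB false (X.take i) (X[i]).1 (X[i]).2 ((Y ++ [(y, V)]).take j)
          ((Y ++ [(y, V)])[j]).1 ((Y ++ [(y, V)])[j]).2 (Z'[i * (Y.length + 1) + j]).2 :=
    fun i hi j hj => by
      obtain ⟨hk, h12⟩ := hZ'.entry hi hj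
      simp only [hlY] at hk h12
      exact ⟨hk, h12⟩
  have hθX : ∀ p : A.Var × B.Var, InCtx X p.1 → InCtx Y p.2 → θ p = .var p := by
    rintro ⟨p1, p2⟩ hp1 hp2
    obtain ⟨i, hi, rfl⟩ := inCtx_iff.1 hp1
    obtain ⟨j, hj, rfl⟩ := inCtx_iff.1 hp2
    obtain ⟨hk, h1, -⟩ := hent i hi j (by simp; omega)
    rw [List.getElem_append_left hj] at h1
    rw [← h1, hθ _ hk, h1]
    exact (ho1 i j hi hj _).var_var
  have hθy : ∀ i (hi : i < X.length) (hk : i * (Y.length + 1) + Y.length < out.length),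
      θ ((X[i]).1, y) = out[i * (Y.length + 1) + Y.length] := fun i hi hk => by
    obtain ⟨hk, h1, -⟩ := hent i hi Y.length (by simp)
    simp only [List.getElem_concat_length] at h1
    rw [← h1, hθ _ hk]
  have hko : ∀ i < X.length, i * (Y.length + 1) + Y.length < out.length := fun i hi => by
    rw [hol]; exact index_lt_mul hi Y.length.lt_succ_self
  refine isMor_of_substOK hs dZ dZ' (θ := θ) (fun k hk => ?_)
    (List.ext_getElem (by simp [hl]) fun k hk hk' => by
      rw [List.getElem_map, hθ k (by simpa using hk')])
  obtain ⟨i, hi, j, hj, rfl⟩ := exists_index_of_lt_mul (hlY ▸ hZ'.1 ▸ hk)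
  obtain ⟨hk, h1, h2⟩ := hent i hi j (hlY ▸ hj)
  rw [h1]
  rcases Nat.lt_succ_iff_lt_or_eq.1 hj with hj' | rfl
  · simp only [List.getElem_append_left hj', List.take_append_of_le_length hj'.le] at h2 ⊢
    obtain ⟨hkZ, h1Z, h2Z⟩ := hZ.entry hi hj'
    have hW := h2.unique hA hB h2Z (gX.take i) (gX.sorts i hi) (gY.take j) (gY.sorts j hj')
    rw [hθX _ (inCtx_getElem hi) (inCtx_getElem hj'), hW, SortE.subst_eq_self, ← h1Z]
    · exact dZ.ctx_var hs hkZ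
    · intro p hp
      rcases h2Z.occurs hA hB (gX.take i) (gX.sorts i hi) (gY.take j) (gY.sorts j hj') hp with
        ⟨hp1, hp2⟩ | ⟨hp1, hp2⟩
      · refine hθX p (inCtx_of_take hp1) ?_
        rcases hp2 with hp2 | hp2
        exacts [inCtx_of_take hp2, hp2 ▸ inCtx_getElem hj']
      · exact hθX p (hp1 ▸ inCtx_getElem hi) (inCtx_of_take hp2)
  · simp only [List.getElem_concat_length, List.take_left'] at h2 ⊢
    obtain ⟨Z0, hZ0, hsub⟩ := hZ.exists_take (i + 1) Y.length
    rw [List.take_length, List.take_succ_eq_append_getElem hi] at hZ0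
    have key := hder.sort_term hA hB hchA hchB (hX.sort_of_ctx hi) (gX.ne_of_mem_take hi) hv hy
      ((Nat.mul_le_mul_right _ (ht_sort_le_htCtx hX hi)).trans hh) dZ hZ0
      hsub (ho2 i hi (hko i hi)) h2
      (g := fun l => out.getD (l * (Y.length + 1) + Y.length) (.var ((X[i]).1, y)))
      fun l hl => by
        have hl' : l < i ∧ l < X.length := by simpa using hl
        have := ho2 l hl'.2 (hko l hl'.2)
        simpa [List.take_take, hl'.1.le, hko l hl'.2] using this
    rw [hθy i hi (hko i hi)]
    convert key using 2
    refine SortE.subst_congr fun p hp => ?_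
    obtain ⟨p1, p2⟩ := p
    have hcase : InCtx X p1 ∧ InCtx Y p2 ∨ InCtx (X.take i) p1 ∧ p2 = y := by
      rcases h2.occurs hA hB (gX.take i) (gX.sorts i hi) gY wV hp with
        ⟨hp1, hp2 | hp2⟩ | ⟨hp1, hp2⟩
      exacts [.inl ⟨inCtx_of_take hp1, hp2⟩, .inr ⟨hp1, hp2⟩,
        .inl ⟨(show p1 = _ from hp1) ▸ inCtx_getElem hi, hp2⟩]
    rcases hcase with ⟨hp1, hp2⟩ | ⟨hp1, rfl⟩
    · rw [lookupV_pairsL_of_ne (ne_of_inCtx hy hp2)]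
      exact hθX _ hp1 hp2
    · obtain ⟨l, hl, rfl⟩ := inCtx_iff.1 hp1
      have hl' : l < i ∧ l < X.length := by simpa using hl
      rw [lookupV_pairsL_getElem (gX.take i).nodup hl]
      simp only [List.getElem_take]
      rw [hθy l hl'.2 (hko l hl'.2)]
      simp [hko l hl'.2]

end

/-- Suppose `(𝔸,𝔹)` is `h`-derivable and let `X`, `Y` be
contexts of `𝔸`, `𝔹`.  (1) If `X ⊢ u : U` is derivable with
`ht(X ⊢ u:U) · ht(Y) ≤ h` then, for a variable `x` not in `X`, the tuple
`(x₁,…,x_m,u^U) ⊗ Y` is a context morphism `X⊗Y → X'⊗Y` in `𝔸⊗𝔹`, where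
`X' = (X, x:U)`.  (2) Symmetrically for a derivable `Y ⊢ v : V` with
`ht(X) · ht(Y ⊢ v:V) ≤ h`. -/
theorem tensor_section_morphism
    (A B : Alphabet) (TA : Set (Judg A)) (TB : Set (Judg B))
    (hA : IsGAT TA) (hB : IsGAT TB)
    (chA : PreCtx A → A.Var) (hchA : FreshCh chA)
    (chB : PreCtx B → B.Var) (hchB : FreshCh chB)
    (h : ℕ) (hder : hDerivable TA TB chA chB h)
    (X : PreCtx A) (Y : PreCtx B)
    (hX : Derivable TA (.ctx X)) (hY : Derivable TB (.ctx Y)) :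
    (∀ (u : Expr A) (U : SortE A) (x : A.Var) (out : List (Expr (A.tensor B)))
        (ZXY ZX'Y : PreCtx (A.tensor B)),
        Derivable TA (.term X u U) →
        ht TA (.term X u U) * htCtx TB Y ≤ h →
        (∀ p ∈ X, p.1 ≠ x) →
        TSecL TA TB false X u U Y out →
        TCtx TA TB false X Y ZXY →
        TCtx TA TB false (X ++ [(x, U)]) Y ZX'Y →
        IsMor (tensorAx TA TB chA chB) ZXY ZX'Y out) ∧
    (∀ (v : Expr B) (V : SortE B) (y : B.Var) (out : List (Expr (A.tensor B)))
        (ZXY ZXY' : PreCtx (A.tensor B)),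
        Derivable TB (.term Y v V) →
        htCtx TA X * ht TB (.term Y v V) ≤ h →
        (∀ p ∈ Y, p.1 ≠ y) →
        TSecR TA TB false X Y v V out →
        TCtx TA TB false X Y ZXY →
        TCtx TA TB false X (Y ++ [(y, V)]) ZXY' →
        IsMor (tensorAx TA TB chA chB) ZXY ZXY' out) := by
  exact ⟨fun u U x out ZXY ZX'Y hu hh hx hout hZ hZ' =>
      hder.isMor_secL hA hB hchA hchB hY hu hh hx hout hZ hZ',
    fun v V y out ZXY ZXY' hv hh hy hout hZ hZ' =>
      hder.isMor_secR hA hB hchA hchB hX hv hh hy hout hZ hZ'⟩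

end GATPaper
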